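/- There exists a constant C > 0 such that the following holds. Let B be a finite set and let V be a linear subspace of functions f : B → ℚ. Assume: (1) c₁ is the divisibility constant of V; (2) V has a c₂-bounded integer basis in ℓ_∞; (3) V^⊥ has a c₃-bounded integer basis in ℓ₁; (4) for any b₁, b₂ ∈ B there exists a symmetry π of V with π(b₁) = b₂; (5) the constant functions belong to V; where c₁, c₂, c₃ ≥ 1 are integers. If N is an integer multiple of c₁ satisfying min(N, |B| − N) ≥ C · c₂ · c₃² · dim(V)⁶ · (log(2·c₃·dim(V)))⁶, then there exists a subset T ⊆ B of size |T| = N satisfying (1/|T|)·Σ_{t∈T} f(t) = (1/|B|)·Σ_{b∈B} f(b) for all f ∈ V. -/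

import Mathlib

/-- A vector `f : B → ℚ` is integer-valued. -/
def IsIntVec {B : Type} (f : B → ℚ) : Prop := ∀ b, ∃ z : ℤ, f b = (z : ℚ)

/-- `V` has a `c`-bounded integer basis in `ℓ_∞`: `V` is spanned by integer vectors
whose `ℓ_∞` norm is at most `c`. -/
def HasBoundedIntBasisLinf {B : Type} (V : Submodule ℚ (B → ℚ)) (c : ℕ) : Prop :=
  Submodule.span ℚ {f : B → ℚ | f ∈ V ∧ IsIntVec f ∧ ∀ b, |f b| ≤ (c : ℚ)} = V

/-- The orthogonal complement `V^⊥ = {g : Σ_b f(b)·g(b) = 0 for all f ∈ V}`. -/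
def perpSet {B : Type} [Fintype B] (V : Submodule ℚ (B → ℚ)) : Set (B → ℚ) :=
  {g | ∀ f ∈ V, ∑ b, f b * g b = 0}

/-- `V^⊥` has a `c`-bounded integer basis in `ℓ₁`: `V^⊥` is spanned by integer vectors
whose `ℓ₁` norm is at most `c`. -/
def PerpHasBoundedIntBasisL1 {B : Type} [Fintype B] (V : Submodule ℚ (B → ℚ)) (c : ℕ) : Prop :=
  (Submodule.span ℚ {g : B → ℚ | g ∈ perpSet V ∧ IsIntVec g ∧ ∑ b, |g b| ≤ (c : ℚ)}
      : Set (B → ℚ)) = perpSet V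

/-- `c` is the divisibility constant of `V`: the integers `N` for which some `γ ∈ ℤ^B`
satisfies `Σ_b γ_b·f(b) = (N/|B|)·Σ_b f(b)` for all `f ∈ V` are exactly the multiples
of `c`. -/
def IsDivisibilityConstant {B : Type} [Fintype B] (V : Submodule ℚ (B → ℚ)) (c : ℕ) : Prop :=
  0 < c ∧ ∀ N : ℤ,
    (∃ γ : B → ℤ, ∀ f ∈ V,
        ∑ b, (γ b : ℚ) * f b = (N : ℚ) / (Fintype.card B : ℚ) * ∑ b, f b)
      ↔ (c : ℤ) ∣ N

/-- A symmetry of `V` is a permutation `π` of `B` with `f ∘ π ∈ V` for all `f ∈ V`. -/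
def IsSymmetry {B : Type} (V : Submodule ℚ (B → ℚ)) (π : Equiv.Perm B) : Prop :=
  ∀ f ∈ V, (f ∘ π) ∈ V

open Complex in
/-- The characteristic function of a centred Bernoulli variable, at frequency `2πt`. -/
noncomputable def bernoulliChar (p t : ℝ) : ℂ :=
  (1 - p) * cexp ((-(2 * Real.pi * p * t) : ℝ) * I) + p * cexp ((2 * Real.pi * (1 - p) * t : ℝ) * I)

theorem norm_bernoulliChar_le {p : ℝ} (hp0 : 0 ≤ p) (hp1 : p ≤ 1) (t : ℝ) :
    ‖bernoulliChar p t‖ ≤ Real.exp (-(8 * (p * (1 - p)) * (t - round t) ^ 2)) := by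
  have h1 : bernoulliChar p t = Complex.exp ((-(2 * Real.pi * p * t) : ℝ) * Complex.I) *
      ((1 - p) + p * Complex.exp ((2 * Real.pi * t : ℝ) * Complex.I)) := by
    rw [bernoulliChar, mul_add, mul_left_comm, ← Complex.exp_add]
    congr 1
    · ring
    · congr 2
      push_cast
      ring
  have h2 : ‖bernoulliChar p t‖ ^ 2 = 1 - 2 * (p * (1 - p)) * (1 - Real.cos (2 * Real.pi * t)) := by
    rw [h1, norm_mul, Complex.norm_exp_ofReal_mul_I, one_mul, ← Complex.normSq_eq_norm_sq,
      Complex.normSq_apply]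
    have e1 : ((1 - p : ℂ) + p * Complex.exp ((2 * Real.pi * t : ℝ) * Complex.I)).re
        = (1 - p) + p * Real.cos (2 * Real.pi * t) := by
      rw [Complex.add_re, Complex.re_ofReal_mul, Complex.exp_ofReal_mul_I_re]
      simp
    have e2 : ((1 - p : ℂ) + p * Complex.exp ((2 * Real.pi * t : ℝ) * Complex.I)).im
        = p * Real.sin (2 * Real.pi * t) := by
      rw [Complex.add_im, Complex.im_ofReal_mul, Complex.exp_ofReal_mul_I_im]
      simp
    rw [e1, e2]
    linear_combination p ^ 2 * Real.sin_sq_add_cos_sq (2 * Real.pi * t)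
  have h3 : Real.cos (2 * Real.pi * t) = Real.cos (2 * Real.pi * (t - round t)) := by
    rw [show 2 * Real.pi * (t - round t) = 2 * Real.pi * t - (round t : ℤ) * (2 * Real.pi) by ring,
      Real.cos_sub_int_mul_two_pi]
  have h4 : Real.cos (2 * Real.pi * (t - round t)) ≤ 1 - 8 * (t - round t) ^ 2 := by
    have := Real.cos_le_one_sub_mul_cos_sq (x := 2 * Real.pi * (t - round t)) (by
      rw [abs_mul, abs_of_pos Real.two_pi_pos]
      nlinarith [abs_sub_round t, Real.pi_pos])
    refine this.trans (le_of_eq ?_)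
    field_simp
    ring
  have h5 : ‖bernoulliChar p t‖ ^ 2 ≤
      (Real.exp (-(8 * (p * (1 - p)) * (t - round t) ^ 2))) ^ 2 := by
    rw [h2, h3, ← Real.exp_nat_mul]
    have := Real.add_one_le_exp (((2 : ℕ) : ℝ) * -(8 * (p * (1 - p)) * (t - round t) ^ 2))
    refine le_trans ?_ this
    have hs : 0 ≤ p * (1 - p) := mul_nonneg hp0 (by linarith)
    push_cast
    nlinarith [mul_le_mul_of_nonneg_left h4 hs]
  exact le_of_sq_le_sq h5 (Real.exp_pos _).le

theorem norm_exp_mul_I_sub_le {x : ℝ} (hx : |x| ≤ 1) :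
    ‖Complex.exp (x * Complex.I) - (1 + x * Complex.I - x ^ 2 / 2)‖ ≤ |x| ^ 3 := by
  have hx' : ‖(x : ℂ) * Complex.I‖ = |x| := by simp
  have := Complex.exp_bound (x := x * Complex.I) (by rw [hx']; exact hx) (n := 3) (by norm_num)
  rw [hx'] at this
  have e : ∑ m ∈ Finset.range 3, ((x : ℂ) * Complex.I) ^ m / (m.factorial : ℂ)
      = 1 + x * Complex.I - x ^ 2 / 2 := by
    simp [Finset.sum_range_succ, Nat.factorial, mul_pow]
    ring
  rw [e] at this
  refine this.trans ?_
  have : 0 ≤ |x| ^ 3 := by positivity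
  norm_num [Nat.factorial]
  linarith

/-- Third-order comparison of the Bernoulli characteristic function with a Gaussian. -/
theorem norm_bernoulliChar_mul_exp_sub_one_le {p : ℝ} (hp0 : 0 ≤ p) (hp1 : p ≤ 1) {t : ℝ}
    (ht : |2 * Real.pi * t| ≤ 1) :
    ‖bernoulliChar p t * Real.exp (2 * Real.pi ^ 2 * (p * (1 - p)) * t ^ 2) - 1‖
      ≤ 1000 * (p * (1 - p)) * |t| ^ 3 := by
  set s := 2 * Real.pi * t with hs
  set σ := p * (1 - p) with hσ
  have hσ0 : 0 ≤ σ := mul_nonneg hp0 (by linarith)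
  have hσ1 : σ ≤ 1 / 4 := by nlinarith [sq_nonneg (p - 1 / 2)]
  set y := σ * s ^ 2 / 2 with hy
  have hs2 : s ^ 2 ≤ 1 := by rw [← sq_abs]; nlinarith [abs_nonneg s]
  have hy0 : 0 ≤ y := by positivity
  have hy1 : y ≤ 1 / 8 := by rw [hy]; nlinarith
  have hyy : 2 * Real.pi ^ 2 * σ * t ^ 2 = y := by rw [hy, hs]; ring
  rw [hyy]
  have a1 := norm_exp_mul_I_sub_le (x := -(p * s)) (by
    rw [abs_neg, abs_mul, abs_of_nonneg hp0]; nlinarith [abs_nonneg s])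
  have a2 := norm_exp_mul_I_sub_le (x := (1 - p) * s) (by
    rw [abs_mul, abs_of_nonneg (by linarith : (0 : ℝ) ≤ 1 - p)]; nlinarith [abs_nonneg s])
  set w1 := Complex.exp ((-(p * s) : ℝ) * Complex.I) -
    (1 + (-(p * s) : ℝ) * Complex.I - (-(p * s) : ℝ) ^ 2 / 2) with hw1
  set w2 := Complex.exp (((1 - p) * s : ℝ) * Complex.I) -
    (1 + ((1 - p) * s : ℝ) * Complex.I - ((1 - p) * s : ℝ) ^ 2 / 2) with hw2
  have hphi : bernoulliChar p t = (1 - y : ℝ) + ((1 - p : ℝ) * w1 + (p : ℝ) * w2) := by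
    rw [hw1, hw2, bernoulliChar, hy, hσ]
    rw [show -(2 * Real.pi * p * t) = -(p * s) by rw [hs]; ring,
      show 2 * Real.pi * (1 - p) * t = (1 - p) * s by rw [hs]; ring]
    push_cast
    ring
  have hW : ‖((1 - p : ℝ) : ℂ) * w1 + (p : ℝ) * w2‖ ≤ σ * |s| ^ 3 := by
    refine (norm_add_le _ _).trans ?_
    rw [norm_mul, norm_mul, Complex.norm_real, Complex.norm_real, Real.norm_of_nonneg hp0,
      Real.norm_of_nonneg (by linarith : (0 : ℝ) ≤ 1 - p)]
    rw [abs_neg, abs_mul, abs_of_nonneg hp0, mul_pow] at a1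
    rw [abs_mul, abs_of_nonneg (by linarith : (0 : ℝ) ≤ 1 - p), mul_pow] at a2
    have h3 : 0 ≤ |s| ^ 3 := by positivity
    have b1 := mul_le_mul_of_nonneg_left a1 (by linarith : (0 : ℝ) ≤ 1 - p)
    have b2 := mul_le_mul_of_nonneg_left a2 hp0
    have : (1 - p) * (p ^ 3 * |s| ^ 3) + p * ((1 - p) ^ 3 * |s| ^ 3)
        = σ * |s| ^ 3 * (p ^ 2 + (1 - p) ^ 2) := by rw [hσ]; ring
    have h4 : p ^ 2 + (1 - p) ^ 2 ≤ 1 := by nlinarith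
    have h5 : 0 ≤ σ * |s| ^ 3 := by positivity
    nlinarith
  have hE : |Real.exp y * (1 - y) - 1| ≤ 2 * y ^ 2 := by
    have e1 := Real.add_one_le_exp (-y)
    have e2 := Real.add_one_le_exp y
    have e3 : Real.exp y * (1 - y) ≤ 1 := by
      have : Real.exp y * Real.exp (-y) = 1 := by rw [← Real.exp_add]; simp
      nlinarith [Real.exp_pos y]
    rw [abs_le]
    constructor <;> nlinarith
  have hexp : Real.exp y ≤ 2 := by
    have := Real.abs_exp_sub_one_le (x := y) (by rw [abs_of_nonneg hy0]; linarith)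
    rw [abs_of_nonneg hy0] at this
    have := (abs_le.1 this).2
    linarith
  have hsplit : bernoulliChar p t * Real.exp y - 1 =
      ((Real.exp y * (1 - y) - 1 : ℝ) : ℂ) + ((1 - p : ℝ) * w1 + (p : ℝ) * w2) * (Real.exp y : ℝ) := by
    rw [hphi]; push_cast; ring
  rw [hsplit]
  refine (norm_add_le _ _).trans ?_
  rw [norm_mul, Complex.norm_real, Complex.norm_real, Real.norm_eq_abs,
    Real.norm_of_nonneg (Real.exp_pos y).le]
  have hys : y ^ 2 ≤ σ * |s| ^ 3 / 16 := by
    have : y ^ 2 = σ * (σ * |s| * |s| ^ 3) / 4 := by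
      rw [hy]
      have : |s| * |s| ^ 3 = s ^ 4 := by
        rw [← pow_succ', ← Even.pow_abs (by decide : Even 4) s]
      rw [mul_assoc σ |s|, this]; ring
    rw [this]
    have h3 : 0 ≤ |s| ^ 3 := by positivity
    have h4 : σ * |s| ≤ 1 / 4 := by nlinarith [abs_nonneg s]
    have := mul_le_mul_of_nonneg_right h4 h3
    nlinarith
  have hs3 : |s| ^ 3 = (2 * Real.pi) ^ 3 * |t| ^ 3 := by
    rw [hs, abs_mul, abs_of_pos Real.two_pi_pos, mul_pow]
  have hpi : (2 * Real.pi) ^ 3 ≤ 300 := by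
    have := Real.pi_lt_d2
    have : (2 * Real.pi) ^ 3 ≤ (2 * 3.15) ^ 3 := by
      have := Real.pi_pos
      gcongr
    norm_num at this
    linarith
  have ht3 : 0 ≤ σ * |t| ^ 3 := by positivity
  have hfin : ‖((1 - p : ℝ) : ℂ) * w1 + (p : ℝ) * w2‖ * Real.exp y ≤ σ * |s| ^ 3 * 2 :=
    mul_le_mul hW hexp (Real.exp_pos y).le (by positivity)
  have : σ * |s| ^ 3 ≤ 300 * (σ * |t| ^ 3) := by
    rw [hs3]; nlinarith
  nlinarith

section
open Finset

/-- Pigeonhole: bounded integer vectors admit a nontrivial `{-1,0,1}`-relation. -/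
theorem exists_signed_relation {r d c : ℕ} (hr : (2 * r * c + 1) ^ d < 2 ^ r)
    (u : Fin r → Fin d → ℤ) (hu : ∀ i j, |u i j| ≤ c) :
    ∃ ε : Fin r → ℤ, (∀ i, |ε i| ≤ 1) ∧ (∃ i, ε i ≠ 0) ∧ ∀ j, ∑ i, ε i * u i j = 0 := by
  classical
  let box : Finset (Fin d → ℤ) := Fintype.piFinset fun _ => Finset.Icc (-(r * c : ℤ)) (r * c)
  let F : Finset (Fin r) → Fin d → ℤ := fun s j => ∑ i ∈ s, u i j
  have hmaps : ∀ s ∈ (univ : Finset (Finset (Fin r))), F s ∈ box := by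
    intro s _
    rw [Fintype.mem_piFinset]
    intro j
    rw [Finset.mem_Icc, ← abs_le]
    calc |∑ i ∈ s, u i j| ≤ ∑ i ∈ s, |u i j| := abs_sum_le_sum_abs _ _
      _ ≤ ∑ i ∈ s, (c : ℤ) := sum_le_sum fun i _ => hu i j
      _ = s.card * c := by simp
      _ ≤ r * c := by
        have : s.card ≤ r := by simpa using card_le_univ s
        gcongr
  have hcard : box.card < (univ : Finset (Finset (Fin r))).card := by
    have : box.card = (2 * r * c + 1) ^ d := by
      simp only [box, Fintype.card_piFinset, Int.card_Icc, prod_const, card_univ, Fintype.card_fin]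
      congr 1
      zify
      rw [Int.toNat_of_nonneg (by have : (0 : ℤ) ≤ r * c := by positivity
                                  linarith)]
      ring
    rw [this]
    simpa using hr
  obtain ⟨s, -, s', -, hne, heq⟩ := exists_ne_map_eq_of_card_lt_of_maps_to hcard hmaps
  refine ⟨fun i => (if i ∈ s then 1 else 0) - (if i ∈ s' then 1 else 0), ?_, ?_, ?_⟩
  · intro i
    dsimp only
    split_ifs <;> simp
  · by_contra! h
    apply hne
    ext i
    have := h i
    by_cases h1 : i ∈ s <;> by_cases h2 : i ∈ s' <;> simp_all
  · intro j
    have := congrFun heq j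
    simp only [F] at this
    simp only [sub_mul, sum_sub_distrib, ite_mul, one_mul, zero_mul, sum_ite_mem, univ_inter]
    rw [this, sub_self]

/-- Double counting: the `i`-th and `j`-th coordinates of tuples are independent. -/
theorem sum_tuple_filter_eq {B : Type*} [Fintype B] [DecidableEq B] {r : ℕ} {i j : Fin r}
    (hij : j ≠ i) (b : B) (w : B → ℝ) :
    (Fintype.card B : ℝ) ^ 2 * ∑ t : Fin r → B with t i = b, w (t j)
      = (Fintype.card B : ℝ) ^ r * ∑ x, w x := by
  have key := Finset.prod_univ_sum (R := ℝ) (κ := fun _ : Fin r => B) (fun _ => univ)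
    (fun l x => if l = i then (if x = b then 1 else 0) else if l = j then w x else 1)
  have hR : ∑ t : Fin r → B with t i = b, w (t j) = ∑ t ∈ Fintype.piFinset fun _ : Fin r => univ,
      ∏ l, (if l = i then (if t l = b then (1 : ℝ) else 0) else if l = j then w (t l) else 1) := by
    rw [Fintype.piFinset_univ, sum_filter]
    refine sum_congr rfl fun t _ => ?_
    rw [← mul_prod_erase univ _ (mem_univ i), ← mul_prod_erase _ _ (mem_erase.2 ⟨hij, mem_univ j⟩)]
    rw [prod_eq_one (s := (univ.erase i).erase j)]
    · simp [hij]
    · intro l hl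
      simp only [mem_erase, mem_univ, and_true] at hl
      simp [hl.1, hl.2]
  rw [hR, ← key, ← mul_prod_erase univ _ (mem_univ i),
    ← mul_prod_erase _ _ (mem_erase.2 ⟨hij, mem_univ j⟩)]
  rw [prod_congr (g := fun _ => (Fintype.card B : ℝ)) rfl (s₁ := (univ.erase i).erase j)]
  · simp only [prod_const]
    rw [card_erase_of_mem (mem_erase.2 ⟨hij, mem_univ j⟩), card_erase_of_mem (mem_univ i)]
    simp only [card_univ, Fintype.card_fin, ↓reduceIte, hij, sum_ite_eq', mem_univ, one_mul]
    have h2 : 2 ≤ r := by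
      have := i.2; have := j.2
      have : (j : ℕ) ≠ i := fun h => hij (Fin.ext h)
      omega
    obtain ⟨k, rfl⟩ := Nat.exists_eq_add_of_le h2
    rw [show 2 + k - 1 - 1 = k by omega, pow_add]
    ring
  · intro l hl
    simp only [mem_erase, mem_univ, and_true] at hl
    simp [hl.1, hl.2]

/-- If every `r`-tuple carries a relation, the relations are invariant under a transitive family of
permutations, and `w` is subadditive along relations, then `w` cannot be concentrated. -/
theorem sq_le_of_relations {B : Type*} [Fintype B] {r : ℕ}
    (R : (Fin r → B) → Fin r → Prop) (hR : ∀ t, ∃ i, R t i)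
    (hsymm : ∀ b b' : B, ∃ π : Equiv.Perm B, π b = b' ∧ ∀ t i, R t i → R (π ∘ t) i)
    (w : B → ℝ) (hw0 : ∀ b, 0 ≤ w b)
    (hw : ∀ t i, R t i → w (t i) ≤ ∑ j ∈ univ.erase i, w (t j)) (b : B) :
    w b ^ 2 ≤ (r : ℝ) ^ 3 / Fintype.card B * ∑ x, w x ^ 2 := by
  classical
  set n := Fintype.card B with hn
  have hn0 : (0 : ℝ) < n := by
    have : 0 < n := Fintype.card_pos_iff.2 ⟨b⟩
    exact_mod_cast this
  have hr0 : 0 < r := by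
    obtain ⟨i, -⟩ := hR (fun _ => b)
    exact i.pos
  let Ω : Fin r → Finset (Fin r → B) := fun i => univ.filter fun t => R t i
  let Ωb : Fin r → B → Finset (Fin r → B) := fun i x => univ.filter fun t => R t i ∧ t i = x
  obtain ⟨i, hi⟩ : ∃ i, n ^ r ≤ r * (Ω i).card := by
    by_contra! h
    have h1 : n ^ r ≤ ∑ i, (Ω i).card := by
      have : (univ : Finset (Fin r → B)) ⊆ univ.biUnion Ω := by
        intro t _
        obtain ⟨i, hi⟩ := hR t
        exact mem_biUnion.2 ⟨i, mem_univ _, by simp [Ω, hi]⟩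
      calc n ^ r = (univ : Finset (Fin r → B)).card := by simp [hn]
        _ ≤ _ := card_le_card this
        _ ≤ _ := card_biUnion_le
    have h2 : r * ∑ i, (Ω i).card < r * n ^ r := by
      rw [mul_sum]
      calc ∑ i, r * (Ω i).card < ∑ _i : Fin r, n ^ r :=
            sum_lt_sum_of_nonempty ⟨⟨0, hr0⟩, mem_univ _⟩ fun i _ => h i
        _ = r * n ^ r := by simp
    exact absurd (Nat.mul_le_mul_left r h1) (not_le.2 h2)
  have hle : ∀ x, (Ωb i x).card ≤ (Ωb i b).card := by
    intro x
    obtain ⟨π, hπ, hπR⟩ := hsymm x b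
    refine card_le_card_of_injOn (fun t => π ∘ t) ?_ ?_
    · intro t ht
      simp only [Ωb, coe_filter, mem_univ, true_and, Set.mem_ofPred_eq] at ht ⊢
      exact ⟨hπR t i ht.1, by simp [ht.2, hπ]⟩
    · intro t _ t' _ h
      funext l
      exact π.injective (congrFun h l)
  have hΩ : (Ω i).card ≤ n * (Ωb i b).card := by
    have : (Ω i).card = ∑ x, (Ωb i x).card := by
      rw [card_eq_sum_card_fiberwise (f := fun t => t i) (t := univ) (fun _ _ => mem_univ _)]
      refine sum_congr rfl fun x _ => ?_
      congr 1
      ext t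
      simp [Ω, Ωb]
    rw [this]
    calc ∑ x, (Ωb i x).card ≤ ∑ _x : B, (Ωb i b).card := sum_le_sum fun x _ => hle x
      _ = _ := by simp [hn]
  have hbig : (n : ℝ) ^ r ≤ r * (n * (Ωb i b).card) := by
    exact_mod_cast hi.trans (Nat.mul_le_mul_left r hΩ)
  have hpt : ∀ t ∈ Ωb i b, w b ^ 2 ≤ r * ∑ j ∈ univ.erase i, w (t j) ^ 2 := by
    intro t ht
    simp only [Ωb, mem_filter, mem_univ, true_and] at ht
    have h1 := hw t i ht.1
    rw [ht.2] at h1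
    calc w b ^ 2 ≤ (∑ j ∈ univ.erase i, w (t j)) ^ 2 := by
          have := hw0 b
          gcongr
      _ ≤ (univ.erase i).card * ∑ j ∈ univ.erase i, w (t j) ^ 2 := sq_sum_le_card_mul_sum_sq
      _ ≤ r * ∑ j ∈ univ.erase i, w (t j) ^ 2 := by
          have : (univ.erase i).card ≤ r := by simp
          gcongr
  have hsum : n ^ 2 * ((Ωb i b).card * w b ^ 2) ≤ r * (r * (n ^ r * ∑ x, w x ^ 2)) := by
    calc n ^ 2 * ((Ωb i b).card * w b ^ 2) = n ^ 2 * ∑ t ∈ Ωb i b, w b ^ 2 := by simp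
      _ ≤ n ^ 2 * ∑ t ∈ Ωb i b, r * ∑ j ∈ univ.erase i, w (t j) ^ 2 := by
          gcongr with t ht
          exact hpt t ht
      _ ≤ n ^ 2 * ∑ t : Fin r → B with t i = b, r * ∑ j ∈ univ.erase i, w (t j) ^ 2 := by
          refine mul_le_mul_of_nonneg_left
            (sum_le_sum_of_subset_of_nonneg (N := ℝ) ?_ ?_) (by positivity)
          · intro t ht
            simp only [Ωb, mem_filter, mem_univ, true_and] at ht ⊢
            exact ht.2
          · intros
            positivity
      _ = r * ∑ j ∈ univ.erase i, ((n : ℝ) ^ 2 * ∑ t : Fin r → B with t i = b, w (t j) ^ 2) := by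
          rw [← mul_sum, sum_comm, ← mul_sum]
          ring
      _ = r * ∑ j ∈ univ.erase i, ((n : ℝ) ^ r * ∑ x, w x ^ 2) := by
          congr 1
          refine sum_congr rfl fun j hj => ?_
          exact sum_tuple_filter_eq (ne_of_mem_erase hj) b fun x => w x ^ 2
      _ ≤ r * (r * (n ^ r * ∑ x, w x ^ 2)) := by
          rw [sum_const, nsmul_eq_mul]
          have : (univ.erase i).card ≤ r := by simp
          have : 0 ≤ ∑ x, w x ^ 2 := by positivity
          gcongr
  have hr0' : (0 : ℝ) < r := by exact_mod_cast hr0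
  have h3 : (n : ℝ) ^ r * (n * w b ^ 2) ≤ n ^ r * (r ^ 3 * ∑ x, w x ^ 2) := by
    calc (n : ℝ) ^ r * (n * w b ^ 2) ≤ (r * (n * (Ωb i b).card)) * (n * w b ^ 2) := by gcongr
      _ = r * (n ^ 2 * ((Ωb i b).card * w b ^ 2)) := by ring
      _ ≤ r * (r * (r * (n ^ r * ∑ x, w x ^ 2))) := by gcongr
      _ = _ := by ring
  have h4 := le_of_mul_le_mul_left h3 (by positivity)
  rw [div_mul_eq_mul_div, le_div_iff₀ hn0]
  linarith

end

section
open Finset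

/-- The real linear combinations of integer vectors. -/
noncomputable def intEval {B : Type*} {d : ℕ} (f : Fin d → B → ℤ) :
    (Fin d → ℝ) →ₗ[ℝ] (B → ℝ) :=
  Fintype.linearCombination ℝ fun i b => (f i b : ℝ)

theorem intEval_apply {B : Type*} {d : ℕ} (f : Fin d → B → ℤ) (θ : Fin d → ℝ) (b : B) :
    intEval f θ b = ∑ i, θ i * f i b := by
  simp [intEval, Fintype.linearCombination_apply]

theorem intEval_intCast {B : Type*} {d : ℕ} (f : Fin d → B → ℤ) (z : Fin d → ℤ) (b : B) :
    intEval f (fun i => (z i : ℝ)) b = ((∑ i, z i * f i b : ℤ) : ℝ) := by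
  rw [intEval_apply]; push_cast; rfl

/-- The characteristic function of a centred sum of independent Bernoulli vectors. -/
noncomputable def charProd {B : Type*} [Fintype B] {d : ℕ} (f : Fin d → B → ℤ) (p : ℝ)
    (θ : Fin d → ℝ) : ℂ :=
  ∏ b, bernoulliChar p (intEval f θ b)

theorem charProd_eq_sum {B : Type*} [Fintype B] [DecidableEq B] {d : ℕ} (f : Fin d → B → ℤ) {p : ℝ}
    {a : Fin d → ℤ} (ha : ∀ i, (a i : ℝ) = p * ∑ b, (f i b : ℝ)) (θ : Fin d → ℝ) :
    charProd f p θ = ∑ T : Finset B, ((p : ℂ) ^ T.card * (1 - p) ^ (univ \ T).card) *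
      ∏ i, Complex.exp (2 * Real.pi * ((∑ b ∈ T, f i b) - a i : ℤ) * Complex.I * θ i) := by
  simp only [charProd, bernoulliChar]
  simp_rw [add_comm ((1 - p : ℂ) * _)]
  rw [prod_add, powerset_univ]
  refine sum_congr rfl fun T _ => ?_
  rw [prod_mul_distrib, prod_mul_distrib, prod_const, prod_const, mul_mul_mul_comm]
  congr 1
  rw [← Complex.exp_sum, ← Complex.exp_sum, ← Complex.exp_add, ← Complex.exp_sum]
  congr 1
  have h1 : ∑ b ∈ T, (2 * Real.pi * (1 - p) * intEval f θ b) +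
      ∑ b ∈ univ \ T, (-(2 * Real.pi * p * intEval f θ b)) =
      ∑ i, 2 * Real.pi * ((∑ b ∈ T, f i b) - a i : ℤ) * θ i := by
    have h2 : ∑ b ∈ univ \ T, (-(2 * Real.pi * p * intEval f θ b)) =
        ∑ b, (-(2 * Real.pi * p * intEval f θ b)) - ∑ b ∈ T, (-(2 * Real.pi * p * intEval f θ b)) :=
      sum_sdiff_eq_sub (subset_univ T)
    have h3 : ∑ b ∈ T, intEval f θ b = ∑ i, (∑ b ∈ T, (f i b : ℝ)) * θ i := by
      simp only [intEval_apply, sum_mul]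
      rw [sum_comm]
      exact sum_congr rfl fun i _ => sum_congr rfl fun b _ => mul_comm _ _
    have h4 : ∑ b, intEval f θ b = ∑ i, (∑ b, (f i b : ℝ)) * θ i := by
      simp only [intEval_apply, sum_mul]
      rw [sum_comm]
      exact sum_congr rfl fun i _ => sum_congr rfl fun b _ => mul_comm _ _
    rw [h2, sum_neg_distrib, sum_neg_distrib, ← mul_sum, ← mul_sum, ← mul_sum, h3, h4]
    calc _ = 2 * Real.pi * (∑ i, (∑ b ∈ T, (f i b : ℝ)) * θ i
              - ∑ i, (p * ∑ b, (f i b : ℝ)) * θ i) := by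
            simp only [mul_assoc p, ← mul_sum]; ring
      _ = _ := by
            rw [← sum_sub_distrib, mul_sum]
            refine sum_congr rfl fun i _ => ?_
            rw [← ha]; push_cast; ring
  have h5 := congrArg (fun x : ℝ => (x : ℂ) * Complex.I) h1
  simp only [Complex.ofReal_add, Complex.ofReal_sum, add_mul, sum_mul] at h5
  rw [h5]
  refine sum_congr rfl fun i _ => ?_
  push_cast
  ring

theorem charProd_add_int {B : Type*} [Fintype B] {d : ℕ} (f : Fin d → B → ℤ) {p : ℝ}
    {a : Fin d → ℤ} (ha : ∀ i, (a i : ℝ) = p * ∑ b, (f i b : ℝ)) (θ : Fin d → ℝ) (z : Fin d → ℤ) :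
    charProd f p (fun i => z i + θ i) = charProd f p θ := by
  classical
  rw [charProd_eq_sum f ha, charProd_eq_sum f ha]
  refine sum_congr rfl fun T _ => ?_
  congr 1
  refine prod_congr rfl fun i _ => ?_
  rw [Complex.exp_eq_exp_iff_exists_int]
  exact ⟨((∑ b ∈ T, f i b) - a i) * z i, by push_cast; ring⟩

theorem continuous_charProd {B : Type*} [Fintype B] {d : ℕ} (f : Fin d → B → ℤ) (p : ℝ) :
    Continuous (charProd f p) := by
  have : ∀ b, Continuous fun θ => intEval f θ b := fun b => by
    simp only [intEval_apply]; fun_prop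
  unfold charProd bernoulliChar
  fun_prop

open MeasureTheory in
theorem integral_Ico_exp_eq_zero {m : ℤ} (hm : m ≠ 0) :
    ∫ t in Set.Ico (0 : ℝ) 1, Complex.exp (2 * Real.pi * m * Complex.I * t) = 0 := by
  rw [integral_Ico_eq_integral_Ioc, ← intervalIntegral.integral_of_le zero_le_one]
  have hc : (2 * Real.pi * m * Complex.I : ℂ) ≠ 0 := by
    simp [Real.pi_ne_zero, hm]
  rw [integral_exp_mul_complex hc]
  have : Complex.exp (2 * Real.pi * m * Complex.I * (1 : ℝ)) = 1 := by
    rw [Complex.exp_eq_one_iff]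
    exact ⟨m, by push_cast; ring⟩
  rw [this]
  simp

open MeasureTheory in
theorem exists_subset_of_integral_charProd_ne_zero {B : Type*} [Fintype B] {d : ℕ}
    (f : Fin d → B → ℤ) {p : ℝ} {a : Fin d → ℤ} (ha : ∀ i, (a i : ℝ) = p * ∑ b, (f i b : ℝ))
    (h : ∫ θ in ZSpan.fundamentalDomain (Pi.basisFun ℝ (Fin d)), charProd f p θ ≠ 0) :
    ∃ T : Finset B, ∀ i, ∑ b ∈ T, f i b = a i := by
  classical
  by_contra! hT
  apply h
  simp only [charProd_eq_sum f ha]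
  have hvol : (volume : Measure (Fin d → ℝ)).restrict (ZSpan.fundamentalDomain (Pi.basisFun ℝ (Fin d)))
      = Measure.pi fun _ => volume.restrict (Set.Ico (0 : ℝ) 1) := by
    rw [ZSpan.fundamentalDomain_pi_basisFun, volume_pi, Measure.restrict_pi_pi]
  rw [integral_finsetSum]
  · refine sum_eq_zero fun T _ => ?_
    rw [integral_const_mul, hvol]
    rw [integral_fintype_prod_eq_prod (𝕜 := ℂ)
      (fun i (t : ℝ) => Complex.exp (2 * Real.pi * ((∑ b ∈ T, f i b) - a i : ℤ) * Complex.I * t))]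
    obtain ⟨i, hi⟩ := hT T
    rw [prod_eq_zero (mem_univ i) (integral_Ico_exp_eq_zero (sub_ne_zero.2 hi)), mul_zero]
  · intro T _
    have hb : Bornology.IsBounded (ZSpan.fundamentalDomain (Pi.basisFun ℝ (Fin d))) :=
      ZSpan.fundamentalDomain_isBounded _
    refine IntegrableOn.mono_set (t := closure _) ?_ subset_closure
    refine ContinuousOn.integrableOn_compact hb.isCompact_closure (Continuous.continuousOn ?_)
    fun_prop

/-- Integer translates of a point, through the standard lattice. -/
theorem existsUnique_span_basisFun_iff {d : ℕ} (P : (Fin d → ℝ) → Prop) (x : Fin d → ℝ) :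
    (∃! g : Submodule.span ℤ (Set.range (Pi.basisFun ℝ (Fin d))), P (g +ᵥ x)) ↔
      ∃! z : Fin d → ℤ, P (fun i => z i + x i) := by
  have hmem : ∀ z : Fin d → ℤ, (fun i => (z i : ℝ)) ∈
      Submodule.span ℤ (Set.range (Pi.basisFun ℝ (Fin d))) := fun z => by
    rw [Module.Basis.mem_span_iff_repr_mem]
    intro i
    exact ⟨z i, by simp⟩
  have hsurj : ∀ g : Submodule.span ℤ (Set.range (Pi.basisFun ℝ (Fin d))),
      ∃ z : Fin d → ℤ, (g : Fin d → ℝ) = fun i => (z i : ℝ) := fun g => by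
    have := (Module.Basis.mem_span_iff_repr_mem ℤ (Pi.basisFun ℝ (Fin d)) (g : Fin d → ℝ)).1 g.2
    choose z hz using this
    exact ⟨z, funext fun i => by simpa using (hz i).symm⟩
  constructor
  · rintro ⟨g, hg, hu⟩
    obtain ⟨z, hz⟩ := hsurj g
    refine ⟨z, ?_, fun z' hz' => ?_⟩
    · have : (g +ᵥ x) = fun i => (z i : ℝ) + x i := by
        rw [Submodule.vadd_def, hz]; rfl
      simpa only [this] using hg
    · have h2 := hu ⟨_, hmem z'⟩ hz'
      have h3 := congrArg Subtype.val h2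
      rw [hz] at h3
      funext i
      exact Int.cast_injective (α := ℝ) (congrFun h3 i)
  · rintro ⟨z, hz, hu⟩
    refine ⟨⟨_, hmem z⟩, hz, fun g hg => ?_⟩
    obtain ⟨z', hz'⟩ := hsurj g
    have : (g +ᵥ x) = fun i => (z' i : ℝ) + x i := by
      rw [Submodule.vadd_def, hz']; rfl
    have := hu z' (by simpa only [this] using hg)
    ext i
    rw [hz', this]

open MeasureTheory in
/-- A set disjoint from its nontrivial integer translates can be completed to a fundamental domain
by a set on which none of the translates meets it. -/
theorem exists_fundamentalDomain_decomposition {d : ℕ} {E : Set (Fin d → ℝ)}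
    (hE : MeasurableSet E)
    (hdisj : ∀ x ∈ E, ∀ z : Fin d → ℤ, (fun i => z i + x i) ∈ E → z = 0) :
    ∃ M : Set (Fin d → ℝ), MeasurableSet M ∧ Disjoint E M ∧ volume M ≤ 1 ∧
      (∀ x ∈ M, ∀ z : Fin d → ℤ, (fun i => z i + x i) ∉ E) ∧
      IsAddFundamentalDomain (Submodule.span ℤ (Set.range (Pi.basisFun ℝ (Fin d)))) (E ∪ M)
        volume := by
  set D := ZSpan.fundamentalDomain (Pi.basisFun ℝ (Fin d)) with hD
  set S : Set (Fin d → ℝ) := ⋃ z : Fin d → ℤ, (fun x i => (z i : ℝ) + x i) ⁻¹' E with hS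
  have hSm : MeasurableSet S := by
    refine MeasurableSet.iUnion fun z => hE.preimage ?_
    fun_prop
  have hDm : MeasurableSet D := ZSpan.fundamentalDomain_measurableSet _
  have hMS : ∀ x ∈ D \ S, ∀ z : Fin d → ℤ, (fun i => z i + x i) ∉ E := fun x hx z hz =>
    hx.2 (Set.mem_iUnion.2 ⟨z, hz⟩)
  refine ⟨D \ S, hDm.diff hSm, ?_, ?_, hMS, ?_⟩
  · refine Set.disjoint_left.2 fun x hx hxM => hMS x hxM 0 ?_
    simpa using hx
  · refine (measure_mono Set.sdiff_subset).trans ?_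
    rw [hD, ZSpan.fundamentalDomain_pi_basisFun, volume_pi, Measure.pi_pi]
    simp
  · refine IsAddFundamentalDomain.mk' (hE.union (hDm.diff hSm)).nullMeasurableSet fun x => ?_
    rw [existsUnique_span_basisFun_iff (fun y => y ∈ E ∪ D \ S)]
    by_cases hx : x ∈ S
    · obtain ⟨z, hz⟩ := Set.mem_iUnion.1 hx
      refine ⟨z, Or.inl hz, fun z' hz' => ?_⟩
      rcases hz' with h | h
      · have := hdisj _ hz (z' - z) (by
          convert h using 2
          simp only [Pi.sub_apply, Int.cast_sub]
          ring)
        exact sub_eq_zero.1 this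
      · exfalso
        refine hMS _ h (z - z') ?_
        have e : (fun i => ((z - z') i : ℝ) + ((z' i : ℝ) + x i)) = fun i => (z i : ℝ) + x i := by
          funext i
          simp only [Pi.sub_apply, Int.cast_sub]
          ring
        rw [e]
        exact hz
    · have hxD := ZSpan.exist_unique_vadd_mem_fundamentalDomain (Pi.basisFun ℝ (Fin d)) x
      rw [existsUnique_span_basisFun_iff (fun y => y ∈ D)] at hxD
      obtain ⟨z, hz, hu⟩ := hxD
      have hxn : ∀ z : Fin d → ℤ, (fun i => z i + x i) ∉ E := fun z hz =>
        hx (Set.mem_iUnion.2 ⟨z, hz⟩)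
      refine ⟨z, Or.inr ⟨hz, fun h => ?_⟩, fun z' hz' => ?_⟩
      · obtain ⟨z', hz'⟩ := Set.mem_iUnion.1 h
        refine hxn (z' + z) ?_
        have e : (fun i => ((z' + z) i : ℝ) + x i) = fun i => (z' i : ℝ) + ((z i : ℝ) + x i) := by
          funext i
          simp only [Pi.add_apply, Int.cast_add]
          ring
        rw [e]
        exact hz'
      · rcases hz' with h | h
        · exact absurd h (hxn z')
        · exact hu z' h.1

end

open MeasureTheory in
theorem integrable_exp_neg_of_quadratic_growth {d : ℕ} {q : (Fin d → ℝ) → ℝ} (hq : Continuous q)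
    {ε : ℝ} (hε : 0 < ε) (hlow : ∀ θ, ε * ‖θ‖ ^ 2 ≤ q θ) {a : ℝ} (ha : 0 < a) :
    Integrable fun θ => Real.exp (-(a * q θ)) := by
  rcases Nat.eq_zero_or_pos d with rfl | hd
  · exact (integrable_const (Real.exp (-(a * q 0)))).congr
      (Filter.Eventually.of_forall fun θ => by rw [Subsingleton.elim θ 0])
  set c : ℝ := a * ε / d with hc
  have hd' : (0 : ℝ) < d := by exact_mod_cast hd
  have hc0 : 0 < c := by positivity
  have hg : Integrable fun θ : Fin d → ℝ => ∏ i, Real.exp (-c * θ i ^ 2) :=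
    Integrable.fintype_prod (f := fun _ x => Real.exp (-c * x ^ 2))
      fun _ => integrable_exp_neg_mul_sq hc0
  refine hg.mono' (by fun_prop) (Filter.Eventually.of_forall fun θ => ?_)
  rw [Real.norm_of_nonneg (Real.exp_pos _).le, ← Real.exp_sum, Real.exp_le_exp, ← Finset.mul_sum,
    neg_mul, neg_le_neg_iff]
  have h1 : ∑ i, θ i ^ 2 ≤ d * ‖θ‖ ^ 2 := by
    calc ∑ i, θ i ^ 2 ≤ ∑ _i : Fin d, ‖θ‖ ^ 2 := by
          refine Finset.sum_le_sum fun i _ => ?_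
          rw [← sq_abs]
          have := norm_le_pi_norm θ i
          rw [Real.norm_eq_abs] at this
          gcongr
      _ = _ := by simp
  calc c * ∑ i, θ i ^ 2 ≤ c * (d * ‖θ‖ ^ 2) := by gcongr
    _ = a * (ε * ‖θ‖ ^ 2) := by rw [hc]; field_simp
    _ ≤ a * q θ := by gcongr; exact hlow θ

open MeasureTheory in
theorem integral_exp_neg_four_mul {d : ℕ} {q : (Fin d → ℝ) → ℝ}
    (hhom : ∀ (c : ℝ) θ, q (c • θ) = c ^ 2 * q θ) :
    ∫ θ, Real.exp (-(4 * q θ)) = (5 / 2) ^ d * ∫ θ, Real.exp (-(25 * q θ)) := by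
  have := Measure.integral_comp_smul (volume : Measure (Fin d → ℝ))
    (fun θ => Real.exp (-(4 * q θ))) (5 / 2)
  simp only [hhom, Module.finrank_fin_fun, smul_eq_mul] at this
  rw [abs_of_pos (by positivity)] at this
  have e : ∀ θ, 4 * ((5 / 2) ^ 2 * q θ) = 25 * q θ := fun θ => by ring
  simp only [e] at this
  rw [this, ← mul_assoc, mul_inv_cancel₀ (by positivity), one_mul]

open MeasureTheory in
/-- Lower bound for the contribution of the neighbourhood of the origin. -/
theorem quarter_integral_le_re_setIntegral {d : ℕ} (hd : 0 < d) {q : (Fin d → ℝ) → ℝ}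
    (hq : Continuous q) {ε : ℝ} (hε : 0 < ε) (hlow : ∀ θ, ε * ‖θ‖ ^ 2 ≤ q θ)
    (hhom : ∀ (c : ℝ) θ, q (c • θ) = c ^ 2 * q θ) {F : (Fin d → ℝ) → ℂ} (hF : Continuous F)
    {E : Set (Fin d → ℝ)} (hE : MeasurableSet E) (hqE : ∀ θ, q θ ≤ d → θ ∈ E)
    (hre : ∀ θ, q θ ≤ d → Real.exp (-(25 * q θ)) / 2 ≤ (F θ).re)
    (hnorm : ∀ θ ∈ E, ‖F θ‖ ≤ Real.exp (-(8 * q θ))) :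
    IntegrableOn F E ∧ (∫ θ, Real.exp (-(25 * q θ))) / 4 ≤ (∫ θ in E, F θ).re := by
  have hint : ∀ {a : ℝ}, 0 < a → Integrable fun θ => Real.exp (-(a * q θ)) := fun ha =>
    integrable_exp_neg_of_quadratic_growth hq hε hlow ha
  have hq0 : ∀ θ, 0 ≤ q θ := fun θ => le_trans (by positivity) (hlow θ)
  have hFint : IntegrableOn F E := by
    refine Integrable.mono' (hint (a := 8) (by norm_num)).integrableOn hF.aestronglyMeasurable ?_
    exact (ae_restrict_mem hE).mono fun θ hθ => hnorm θ hθ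
  refine ⟨hFint, ?_⟩
  set A : Set (Fin d → ℝ) := {θ | (d : ℝ) < q θ} with hA
  have hAm : MeasurableSet A := measurableSet_lt measurable_const hq.measurable
  set L : (Fin d → ℝ) → ℝ := fun θ =>
    Real.exp (-(25 * q θ)) / 2 - 2 * A.indicator (fun θ => Real.exp (-(8 * q θ))) θ with hL
  have hT : Integrable (A.indicator fun θ => Real.exp (-(8 * q θ))) :=
    (hint (by norm_num)).indicator hAm
  have hLint : Integrable L := ((hint (by norm_num)).div_const 2).sub (hT.const_mul 2)
  have hmono : ∀ θ, Real.exp (-(25 * q θ)) ≤ Real.exp (-(8 * q θ)) := fun θ =>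
    Real.exp_le_exp.2 (by linarith [hq0 θ])
  have htail : ∫ θ, A.indicator (fun θ => Real.exp (-(8 * q θ))) θ
      ≤ (∫ θ, Real.exp (-(25 * q θ))) / 8 := by
    calc ∫ θ, A.indicator (fun θ => Real.exp (-(8 * q θ))) θ
        ≤ ∫ θ, Real.exp (-(4 * d)) * Real.exp (-(4 * q θ)) := by
          refine integral_mono hT ((hint (by norm_num)).const_mul _) fun θ => ?_
          by_cases h : θ ∈ A
          · rw [Set.indicator_of_mem h]
            dsimp only
            rw [← Real.exp_add, Real.exp_le_exp]
            have : (d : ℝ) < q θ := h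
            linarith
          · rw [Set.indicator_of_notMem h]
            positivity
      _ = Real.exp (-(4 * d)) * (5 / 2) ^ d * ∫ θ, Real.exp (-(25 * q θ)) := by
          rw [integral_const_mul, integral_exp_neg_four_mul hhom, mul_assoc]
      _ ≤ 1 / 8 * ∫ θ, Real.exp (-(25 * q θ)) := by
          refine mul_le_mul_of_nonneg_right ?_ (integral_nonneg fun θ => (Real.exp_pos _).le)
          have he := Real.exp_one_gt_d9
          have h1 : (5 / 2 : ℝ) ^ d ≤ Real.exp d := by
            rw [← mul_one (d : ℝ), Real.exp_nat_mul]
            gcongr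
            linarith
          have h2 : (8 : ℝ) ≤ Real.exp (3 * d) := by
            have h3 : Real.exp 3 ≤ Real.exp (3 * d) := by
              rw [Real.exp_le_exp]
              have : (1 : ℝ) ≤ d := by exact_mod_cast hd
              linarith
            have h4 : Real.exp 3 = Real.exp 1 ^ 3 := by
              rw [← Real.exp_nat_mul]; norm_num
            have h5 : (2 : ℝ) ^ 3 ≤ Real.exp 1 ^ 3 := by gcongr; linarith
            linarith
          calc Real.exp (-(4 * d)) * (5 / 2) ^ d ≤ Real.exp (-(4 * d)) * Real.exp d := by gcongr
            _ = (Real.exp (3 * d))⁻¹ := by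
              rw [← Real.exp_add, ← Real.exp_neg]; congr 1; ring
            _ ≤ 8⁻¹ := inv_anti₀ (by norm_num) h2
            _ = 1 / 8 := by norm_num
      _ = _ := by ring
  have hLtot : (∫ θ, Real.exp (-(25 * q θ))) / 4 ≤ ∫ θ, L θ := by
    rw [hL, integral_sub ((hint (by norm_num)).div_const 2) (hT.const_mul 2), integral_div,
      integral_const_mul]
    linarith
  have hLE : ∫ θ, L θ ≤ ∫ θ in E, L θ := by
    rw [← integral_indicator hE]
    refine integral_mono hLint (hLint.indicator hE) fun θ => ?_
    by_cases h : θ ∈ E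
    · rw [Set.indicator_of_mem h]
    · rw [Set.indicator_of_notMem h]
      have hθA : θ ∈ A := by
        by_contra hn
        exact h (hqE θ (not_lt.1 hn))
      simp only [hL, Set.indicator_of_mem hθA]
      linarith [hmono θ, Real.exp_pos (-(8 * q θ))]
  have hre' : (∫ θ in E, F θ).re = ∫ θ in E, (F θ).re := (integral_re hFint).symm
  rw [hre']
  refine hLtot.trans (hLE.trans ?_)
  refine setIntegral_mono_on hLint.integrableOn hFint.re hE fun θ hθ => ?_
  by_cases h : θ ∈ A
  · simp only [hL, Set.indicator_of_mem h]
    have h1 := hnorm θ hθ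
    have h2 := (abs_le.1 (Complex.abs_re_le_norm (F θ))).1
    linarith [hmono θ, Real.exp_pos (-(8 * q θ))]
  · simp only [hL, Set.indicator_of_notMem h]
    have := hre θ (not_lt.1 h)
    linarith

open MeasureTheory in
theorem exp_neg_mul_pow_le_integral {d : ℕ} {q : (Fin d → ℝ) → ℝ} (hq : Continuous q)
    {ε : ℝ} (hε : 0 < ε) (hlow : ∀ θ, ε * ‖θ‖ ^ 2 ≤ q θ) {ρ : ℝ} (hρ : 0 ≤ ρ)
    (A : (Fin d → ℝ) →ₗ[ℝ] (Fin d → ℝ)) (hdet : 1 ≤ |LinearMap.det A|)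
    (hA : ∀ t : Fin d → ℝ, (∀ i, t i ∈ Set.Icc 0 ρ) → q (A t) ≤ 1) :
    Real.exp (-25) * ρ ^ d ≤ ∫ θ, Real.exp (-(25 * q θ)) := by
  have hint : Integrable fun θ => Real.exp (-(25 * q θ)) :=
    integrable_exp_neg_of_quadratic_growth hq hε hlow (by norm_num)
  set box : Set (Fin d → ℝ) := Set.pi Set.univ fun _ => Set.Icc 0 ρ with hbox
  have hcomp : IsCompact (A '' box) :=
    (isCompact_univ_pi fun _ => isCompact_Icc).image A.continuous_of_finiteDimensional
  have hvol : ρ ^ d ≤ (volume (A '' box)).toReal := by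
    rw [Measure.addHaar_image_linearMap, ENNReal.toReal_mul,
      ENNReal.toReal_ofReal (abs_nonneg _)]
    have : (volume box).toReal = ρ ^ d := by
      rw [hbox, volume_pi, Measure.pi_pi]
      simp [hρ]
    rw [this]
    exact le_mul_of_one_le_left (by positivity) hdet
  calc Real.exp (-25) * ρ ^ d ≤ (volume (A '' box)).toReal * Real.exp (-25) := by
        rw [mul_comm]; gcongr
    _ = ∫ θ in A '' box, Real.exp (-25) := by
        rw [setIntegral_const, smul_eq_mul, Measure.real]
    _ ≤ ∫ θ in A '' box, Real.exp (-(25 * q θ)) := by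
        refine setIntegral_mono_on (integrableOn_const hcomp.measure_lt_top.ne) hint.integrableOn
          hcomp.measurableSet fun θ hθ => ?_
        obtain ⟨t, ht, rfl⟩ := hθ
        rw [Real.exp_le_exp]
        linarith [hA t fun i => ht i (Set.mem_univ i)]
    _ ≤ ∫ θ, Real.exp (-(25 * q θ)) :=
        setIntegral_le_integral hint (Filter.Eventually.of_forall fun θ => (Real.exp_pos _).le)

section
open Finset

theorem norm_charProd_le {B : Type*} [Fintype B] {d : ℕ} (f : Fin d → B → ℤ) {p : ℝ} (hp0 : 0 ≤ p)
    (hp1 : p ≤ 1) (θ : Fin d → ℝ) :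
    ‖charProd f p θ‖ ≤ Real.exp (-(8 * (p * (1 - p) *
      ∑ b, (intEval f θ b - round (intEval f θ b)) ^ 2))) := by
  rw [charProd, norm_prod, ← mul_assoc, mul_sum, ← sum_neg_distrib, Real.exp_sum]
  exact prod_le_prod (fun _ _ => norm_nonneg _) fun b _ => norm_bernoulliChar_le hp0 hp1 _

theorem half_exp_le_re_charProd {B : Type*} [Fintype B] {d : ℕ} (f : Fin d → B → ℤ) {p : ℝ}
    (hp0 : 0 ≤ p) (hp1 : p ≤ 1) (θ : Fin d → ℝ) {M : ℝ} (hM : ∀ b, |intEval f θ b| ≤ M)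
    (hM1 : 7 * M ≤ 1)
    (hM2 : 1000 * M * (p * (1 - p) * ∑ b, intEval f θ b ^ 2) ≤ 1 / 3) :
    Real.exp (-(25 * (p * (1 - p) * ∑ b, intEval f θ b ^ 2))) / 2 ≤ (charProd f p θ).re := by
  set σ := p * (1 - p) with hσ
  have hσ0 : 0 ≤ σ := mul_nonneg hp0 (by linarith)
  set q := σ * ∑ b, intEval f θ b ^ 2 with hq
  have hq0 : 0 ≤ q := by positivity
  let z : B → ℂ := fun b =>
    bernoulliChar p (intEval f θ b) * Real.exp (2 * Real.pi ^ 2 * σ * intEval f θ b ^ 2) - 1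
  have hz : ∑ b, ‖z b‖ ≤ 1 / 3 := by
    refine le_trans ?_ hM2
    rw [hq, mul_sum, mul_sum]
    refine sum_le_sum fun b _ => ?_
    have hb := hM b
    have hpi := Real.pi_lt_d2
    refine (norm_bernoulliChar_mul_exp_sub_one_le hp0 hp1 ?_).trans ?_
    · rw [abs_mul, abs_of_pos Real.two_pi_pos]
      nlinarith [abs_nonneg (intEval f θ b)]
    · rw [pow_succ, sq_abs]
      have : 0 ≤ 1000 * (p * (1 - p)) * intEval f θ b ^ 2 := by positivity
      nlinarith
  have hprod : charProd f p θ * Real.exp (2 * Real.pi ^ 2 * q) = ∏ b, (1 + z b) := by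
    have : Real.exp (2 * Real.pi ^ 2 * q) = ∏ b, Real.exp (2 * Real.pi ^ 2 * σ * intEval f θ b ^ 2) := by
      rw [← Real.exp_sum, hq, ← mul_sum]
      congr 1
      ring
    rw [this, Complex.ofReal_prod, charProd, ← prod_mul_distrib]
    exact prod_congr rfl fun b _ => by simp only [z]; ring
  have hdist : ‖∏ b, (1 + z b) - 1‖ ≤ 1 / 2 := by
    refine (norm_prod_one_add_sub_one_le univ z).trans ?_
    have h1 : Real.exp (∑ b, ‖z b‖) ≤ Real.exp (1 / 3) := Real.exp_le_exp.2 hz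
    have h2 : Real.exp (1 / 3) ≤ 3 / 2 := by
      have h3 : Real.exp (1 / 3) ^ 3 = Real.exp 1 := by
        rw [← Real.exp_nat_mul]; norm_num
      have h4 := Real.exp_one_lt_d9
      by_contra! h
      have : (3 / 2 : ℝ) ^ 3 < Real.exp (1 / 3) ^ 3 := by gcongr
      rw [h3] at this
      norm_num at this
      linarith
    linarith
  have hre : 1 / 2 ≤ (charProd f p θ).re * Real.exp (2 * Real.pi ^ 2 * q) := by
    rw [← Complex.re_mul_ofReal, hprod]
    have := (abs_le.1 ((Complex.abs_re_le_norm _).trans hdist)).1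
    rw [Complex.sub_re, Complex.one_re] at this
    linarith
  have hle : Real.exp (-(25 * q)) ≤ Real.exp (-(2 * Real.pi ^ 2 * q)) := by
    rw [Real.exp_le_exp, neg_le_neg_iff]
    have : Real.pi ^ 2 ≤ 3.15 ^ 2 := by
      have := Real.pi_pos
      have := Real.pi_lt_d2
      gcongr
    norm_num at this
    nlinarith
  have hone : Real.exp (2 * Real.pi ^ 2 * q) * Real.exp (-(2 * Real.pi ^ 2 * q)) = 1 := by
    rw [← Real.exp_add]; simp
  have := mul_le_mul_of_nonneg_right hre (Real.exp_pos (-(2 * Real.pi ^ 2 * q))).le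
  rw [mul_assoc (charProd f p θ).re, hone] at this
  linarith

open MeasureTheory in
/-- The Fourier-analytic criterion for exact representation of the expected value. -/
theorem exists_subset_sum_eq_of_fourier_bounds {B : Type*} [Fintype B] {d : ℕ} (hd : 0 < d)
    (f : Fin d → B → ℤ) {p : ℝ} (hp0 : 0 < p) (hp1 : p < 1) {a : Fin d → ℤ}
    (ha : ∀ i, (a i : ℝ) = p * ∑ b, (f i b : ℝ)) (hinj : Function.Injective (intEval f))
    {δ κ ρ : ℝ} (hδ1 : δ ≤ 1 / 2) (hδ0 : 0 < δ) (hκ0 : 0 < κ)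
    (hround : ∀ θ, (∀ b, |intEval f θ b - round (intEval f θ b)| < δ) →
      ∃ z : Fin d → ℤ, ∀ b, |intEval f (fun i => z i + θ i) b| < δ)
    (hκ : ∀ θ b, |intEval f θ b| ^ 2 ≤ κ * ∑ x, intEval f θ x ^ 2)
    (hκr : ∀ θ b, |intEval f θ b - round (intEval f θ b)| ^ 2 ≤
      κ * ∑ x, (intEval f θ x - round (intEval f θ x)) ^ 2)
    (hρ : 0 ≤ ρ) (A : (Fin d → ℝ) →ₗ[ℝ] (Fin d → ℝ)) (hdet : 1 ≤ |LinearMap.det A|)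
    (hA : ∀ t : Fin d → ℝ, (∀ i, t i ∈ Set.Icc 0 ρ) →
      p * (1 - p) * ∑ b, intEval f (A t) b ^ 2 ≤ 1)
    (h1 : κ * d < p * (1 - p) * δ ^ 2) (h2 : 10 ^ 7 * κ * d ^ 3 ≤ p * (1 - p))
    (h3 : Real.exp (-(8 * (p * (1 - p)) * δ ^ 2 / κ)) < Real.exp (-25) * ρ ^ d / 4) :
    ∃ T : Finset B, ∀ i, ∑ b ∈ T, f i b = a i := by
  refine exists_subset_of_integral_charProd_ne_zero f ha ?_
  set σ := p * (1 - p) with hσ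
  have hσ0 : 0 < σ := mul_pos hp0 (by linarith)
  have hdR : (1 : ℝ) ≤ d := by exact_mod_cast hd
  let q : (Fin d → ℝ) → ℝ := fun θ => σ * ∑ b, intEval f θ b ^ 2
  have hcont : Continuous (intEval f) := (intEval f).continuous_of_finiteDimensional
  have hcontb : ∀ b, Continuous fun θ => intEval f θ b := fun b => (continuous_apply b).comp hcont
  have hqc : Continuous q := by
    dsimp only [q]
    fun_prop
  obtain ⟨K, hK0, hK⟩ := (intEval f).exists_antilipschitzWith (LinearMap.ker_eq_bot.2 hinj)
  have hK0' : (0 : ℝ) < K := by exact_mod_cast hK0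
  have hlow : ∀ θ, (σ / (K : ℝ) ^ 2) * ‖θ‖ ^ 2 ≤ q θ := by
    intro θ
    have e1 : ‖θ‖ ≤ K * ‖intEval f θ‖ := by
      have := hK.le_mul_dist θ 0
      simpa using this
    have e2 : ‖intEval f θ‖ ^ 2 ≤ ∑ b, intEval f θ b ^ 2 := by
      have e3 : ‖intEval f θ‖ ≤ Real.sqrt (∑ b, intEval f θ b ^ 2) := by
        refine (pi_norm_le_iff_of_nonneg (Real.sqrt_nonneg _)).2 fun b => ?_
        rw [Real.norm_eq_abs]
        refine Real.le_sqrt_of_sq_le ?_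
        rw [sq_abs]
        exact single_le_sum (f := fun b => intEval f θ b ^ 2) (fun b _ => sq_nonneg _) (mem_univ b)
      calc ‖intEval f θ‖ ^ 2 ≤ Real.sqrt (∑ b, intEval f θ b ^ 2) ^ 2 := by gcongr
        _ = _ := Real.sq_sqrt (by positivity)
    have e4 : ‖θ‖ ^ 2 ≤ (K : ℝ) ^ 2 * ∑ b, intEval f θ b ^ 2 := by
      calc ‖θ‖ ^ 2 ≤ (K * ‖intEval f θ‖) ^ 2 := by gcongr
        _ = (K : ℝ) ^ 2 * ‖intEval f θ‖ ^ 2 := by ring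
        _ ≤ _ := by gcongr
    calc (σ / (K : ℝ) ^ 2) * ‖θ‖ ^ 2 ≤ (σ / (K : ℝ) ^ 2) * ((K : ℝ) ^ 2 * ∑ b, intEval f θ b ^ 2) := by
          gcongr
      _ = q θ := by simp only [q]; field_simp
  have hhom : ∀ (c : ℝ) θ, q (c • θ) = c ^ 2 * q θ := by
    intro c θ
    simp only [q, map_smul, Pi.smul_apply, smul_eq_mul, mul_pow, ← mul_sum]
    ring
  set E : Set (Fin d → ℝ) := {θ | ∀ b, |intEval f θ b| < δ} with hE
  have hEm : MeasurableSet E := by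
    rw [hE, Set.ofPred_forall]
    exact MeasurableSet.iInter fun b =>
      measurableSet_lt (hcontb b).abs.measurable measurable_const
  have hsmall : ∀ θ, q θ ≤ d → ∀ b, |intEval f θ b| ^ 2 ≤ κ * d / σ := by
    intro θ hθ b
    refine (hκ θ b).trans ?_
    rw [mul_div_assoc]
    gcongr
    rw [le_div_iff₀ hσ0, mul_comm]
    exact hθ
  have hqE : ∀ θ, q θ ≤ d → θ ∈ E := by
    intro θ hθ b
    have : |intEval f θ b| ^ 2 < δ ^ 2 := by
      refine (hsmall θ hθ b).trans_lt ?_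
      rw [div_lt_iff₀ hσ0]
      linarith
    exact lt_of_pow_lt_pow_left₀ 2 hδ0.le this
  have hdisj : ∀ x ∈ E, ∀ z : Fin d → ℤ, (fun i => z i + x i) ∈ E → z = 0 := by
    intro x hx z hz
    have hzero : intEval f (fun i => (z i : ℝ)) = 0 := by
      funext b
      have e1 : intEval f (fun i => z i + x i) b = intEval f (fun i => (z i : ℝ)) b + intEval f x b := by
        rw [show (fun i => (z i : ℝ) + x i) = (fun i => (z i : ℝ)) + x from rfl, map_add]
        rfl
      have e2 := abs_lt.1 (hx b)
      have e3 := abs_lt.1 (hz b)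
      rw [e1, intEval_intCast] at e3
      rw [intEval_intCast]
      have e4 : |((∑ i, z i * f i b : ℤ) : ℝ)| < 1 := abs_lt.2 ⟨by linarith, by linarith⟩
      have e5 : |∑ i, z i * f i b| < 1 := by exact_mod_cast e4
      rw [Int.abs_lt_one_iff.1 e5]
      simp
    have := hinj (hzero.trans (map_zero (intEval f)).symm)
    funext i
    exact Int.cast_injective (α := ℝ) (by simpa using congrFun this i)
  obtain ⟨M, hMm, hEM, hMvol, hMsep, hfund⟩ := exists_fundamentalDomain_decomposition hEm hdisj
  have hFc := continuous_charProd f p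
  obtain ⟨hEint, hmain⟩ := quarter_integral_le_re_setIntegral hd hqc (by positivity) hlow hhom
    hFc hEm hqE
    (by
      intro θ hθ
      have hM2 : (Real.sqrt (κ * d / σ)) ^ 2 * (10 ^ 7 * d ^ 2) ≤ 1 := by
        rw [Real.sq_sqrt (by positivity), div_mul_eq_mul_div, div_le_one hσ0]
        linarith
      set m := Real.sqrt (κ * d / σ) with hm
      have hm0 : 0 ≤ m := Real.sqrt_nonneg _
      have hmd : 3000 * (m * d) ≤ 1 := by
        by_contra! h
        have : (1 : ℝ) ^ 2 < (3000 * (m * d)) ^ 2 := by gcongr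
        nlinarith [mul_nonneg (sq_nonneg m) (sq_nonneg (d : ℝ))]
      refine half_exp_le_re_charProd f hp0.le hp1.le θ (M := m) (fun b => ?_) ?_ ?_
      · exact Real.le_sqrt_of_sq_le (hsmall θ hθ b)
      · nlinarith
      · have : m * q θ ≤ m * d := by gcongr
        simp only [q] at this
        linarith)
    (by
      intro θ hθ
      have := norm_charProd_le f hp0.le hp1.le θ
      have hr : ∀ b, round (intEval f θ b) = 0 := fun b => by
        rw [round_eq_zero_iff]
        have := abs_lt.1 (hθ b)
        exact ⟨by linarith, by linarith⟩
      simpa only [hr, Int.cast_zero, sub_zero] using this)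
  have hG := exp_neg_mul_pow_le_integral hqc (by positivity) hlow hρ A hdet hA
  set β := Real.exp (-(8 * σ * δ ^ 2 / κ)) with hβ
  have hminor : ∀ θ ∈ M, ‖charProd f p θ‖ ≤ β := by
    intro θ hθ
    refine (norm_charProd_le f hp0.le hp1.le θ).trans ?_
    obtain ⟨b, hb⟩ : ∃ b, δ ≤ |intEval f θ b - round (intEval f θ b)| := by
      by_contra! h
      obtain ⟨z, hz⟩ := hround θ h
      exact hMsep θ hθ z hz
    rw [hβ, Real.exp_le_exp, neg_le_neg_iff, div_le_iff₀ hκ0]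
    have e1 : δ ^ 2 ≤ |intEval f θ b - round (intEval f θ b)| ^ 2 := by gcongr
    have e2 := e1.trans (hκr θ b)
    nlinarith
  have hMint : ‖∫ θ in M, charProd f p θ‖ ≤ β := by
    refine (norm_setIntegral_le_of_norm_le_const (hMvol.trans_lt ENNReal.one_lt_top)
      hminor).trans ?_
    have : volume.real M ≤ 1 := ENNReal.toReal_le_of_le_ofReal zero_le_one (by simpa using hMvol)
    exact mul_le_of_le_one_right (Real.exp_pos _).le this
  have hMfin : IntegrableOn (charProd f p) M := by
    refine Measure.integrableOn_of_bounded (hMvol.trans_lt ENNReal.one_lt_top).ne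
      hFc.aestronglyMeasurable (M := β) ?_
    exact (ae_restrict_mem hMm).mono hminor
  have hD : ∫ θ in ZSpan.fundamentalDomain (Pi.basisFun ℝ (Fin d)), charProd f p θ
      = ∫ θ in E ∪ M, charProd f p θ := by
    have : VAddInvariantMeasure (Submodule.span ℤ (Set.range (Pi.basisFun ℝ (Fin d)))) (Fin d → ℝ)
        volume := inferInstanceAs <| VAddInvariantMeasure
          (Submodule.span ℤ (Set.range (Pi.basisFun ℝ (Fin d)))).toAddSubgroup (Fin d → ℝ) volume
    refine (ZSpan.isAddFundamentalDomain (Pi.basisFun ℝ (Fin d)) volume).setIntegral_eq hfund ?_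
    intro g x
    have hg := (Module.Basis.mem_span_iff_repr_mem ℤ (Pi.basisFun ℝ (Fin d)) (g : Fin d → ℝ)).1 g.2
    choose z hz using hg
    have : (g +ᵥ x) = fun i => (z i : ℝ) + x i := by
      funext i
      have := hz i
      simp only [Pi.basisFun_repr] at this
      rw [Submodule.vadd_def, vadd_eq_add, Pi.add_apply, ← this]
      rfl
    rw [this, charProd_add_int f ha]
  rw [hD, setIntegral_union hEM hMm hEint hMfin]
  intro h0
  have e1 := congrArg Complex.re h0
  rw [Complex.add_re, Complex.zero_re] at e1
  have e2 := (abs_le.1 ((Complex.abs_re_le_norm _).trans hMint)).1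
  have e3 : Real.exp (-25) * ρ ^ d / 4 ≤ (∫ θ, Real.exp (-(25 * q θ))) / 4 := by linarith
  linarith

end

section
open Finset

/-- Coercion of integer vectors to rational vectors, as a `ℤ`-linear map. -/
def ratCastVec (B : Type*) : (B → ℤ) →ₗ[ℤ] (B → ℚ) :=
  ((Int.castAddHom ℚ).compLeft B).toIntLinearMap

@[simp]
theorem ratCastVec_apply {B : Type*} (f : B → ℤ) (b : B) : ratCastVec B f b = f b := rfl

theorem ratCastVec_injective (B : Type*) : Function.Injective (ratCastVec B) := fun _ _ h =>
  funext fun b => Int.cast_injective (α := ℚ) (congrFun h b)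

theorem IsIntVec.exists_ratCastVec_eq {B : Type} {f : B → ℚ} (hf : IsIntVec f) :
    ∃ z : B → ℤ, ratCastVec B z = f := by
  choose z hz using hf
  exact ⟨z, funext fun b => (hz b).symm⟩

theorem LinearMap.apply_eq_sum_mul_single {R B M : Type*} [CommSemiring R] [AddCommMonoid M] [Module R M]
    [Fintype B] [DecidableEq B] (φ : (B → R) →ₗ[R] M) (y : B → R) :
    φ y = ∑ b, y b • φ (Pi.single b 1) := by
  rw [LinearMap.pi_apply_eq_sum_univ]
  refine sum_congr rfl fun b _ => ?_
  congr 2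
  funext x
  simp [Pi.single_apply, eq_comm]

theorem injective_intEval_of_linearIndependent {B : Type*} [Fintype B] {d : ℕ} {f : Fin d → B → ℤ}
    (h : LinearIndependent ℚ fun i => ratCastVec B (f i)) : Function.Injective (intEval f) := by
  classical
  obtain ⟨g, hg⟩ := (Fintype.linearCombination ℚ fun i => ratCastVec B (f i)).exists_leftInverse_of_injective
    (LinearMap.ker_eq_bot.2 (linearIndependent_iff_injective_fintypeLinearCombination.1 h))
  have hG : ∀ i j, ∑ b, (f i b : ℚ) * g (Pi.single b 1) j = if i = j then 1 else 0 := by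
    intro i j
    have h1 := congrFun (LinearMap.congr_fun hg (Pi.single i 1)) j
    rw [LinearMap.comp_apply, Fintype.linearCombination_apply_single, one_smul,
      LinearMap.apply_eq_sum_mul_single] at h1
    simpa [Finset.sum_apply, Pi.single_apply, eq_comm] using h1
  rw [injective_iff_map_eq_zero]
  intro θ hθ
  funext j
  have h2 : ∑ b, intEval f θ b * ((g (Pi.single b 1) j : ℚ) : ℝ) = θ j := by
    simp only [intEval_apply, sum_mul]
    rw [sum_comm]
    have h3 : ∀ i, ∑ b, θ i * (f i b : ℝ) * ((g (Pi.single b 1) j : ℚ) : ℝ)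
        = θ i * if i = j then 1 else 0 := by
      intro i
      simp only [mul_assoc, ← mul_sum]
      have := congrArg (Rat.cast : ℚ → ℝ) (hG i j)
      push_cast at this
      rw [this]
      split_ifs <;> simp
    simp [h3]
  rw [← h2, hθ]
  simp

theorem exists_integral_basis {B : Type} [Fintype B] {V : Submodule ℚ (B → ℚ)}
    (hV : Submodule.span ℚ {f | f ∈ V ∧ IsIntVec f} = V) :
    ∃ f : Fin (Module.finrank ℚ V) → B → ℤ, (∀ i, ratCastVec B (f i) ∈ V) ∧
      Function.Injective (intEval f) ∧
      (∀ g : B → ℤ, ratCastVec B g ∈ V → ∃ z : Fin (Module.finrank ℚ V) → ℤ,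
        ∀ b, g b = ∑ i, z i * f i b) ∧
      Submodule.span ℚ (Set.range fun i => ratCastVec B (f i)) = V := by
  let W : Submodule ℤ (B → ℤ) := (V.restrictScalars ℤ).comap (ratCastVec B)
  obtain ⟨n, ⟨bas⟩⟩ := Submodule.nonempty_basis_of_pid (Pi.basisFun ℤ B) W
  let f : Fin n → B → ℤ := fun i => bas i
  have hfV : ∀ i, ratCastVec B (f i) ∈ V := fun i => (bas i).2
  have hexp : ∀ g : B → ℤ, ratCastVec B g ∈ V → ∃ z : Fin n → ℤ, g = ∑ i, z i • f i := by
    intro g hg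
    refine ⟨fun i => bas.repr ⟨g, hg⟩ i, ?_⟩
    have := congrArg W.subtype (bas.sum_repr ⟨g, hg⟩)
    rw [map_sum] at this
    exact this.symm
  have hspan : Submodule.span ℚ (Set.range fun i => ratCastVec B (f i)) = V := by
    refine le_antisymm (Submodule.span_le.2 (Set.range_subset_iff.2 hfV)) ?_
    conv_lhs => rw [← hV]
    refine Submodule.span_le.2 ?_
    rintro g ⟨hgV, hgi⟩
    obtain ⟨g, rfl⟩ := hgi.exists_ratCastVec_eq
    obtain ⟨z, rfl⟩ := hexp g hgV
    rw [map_sum]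
    refine Submodule.sum_mem _ fun i _ => ?_
    rw [map_zsmul]
    exact zsmul_mem (Submodule.subset_span (Set.mem_range_self i)) _
  have hli : LinearIndependent ℚ fun i => ratCastVec B (f i) := by
    rw [← LinearIndependent.iff_fractionRing ℤ ℚ]
    have h1 : LinearIndependent ℤ f := bas.linearIndependent.map' W.subtype (Submodule.ker_subtype W)
    exact h1.map' (ratCastVec B) (LinearMap.ker_eq_bot.2 (ratCastVec_injective B))
  have hn : n = Module.finrank ℚ V := by
    have := finrank_span_eq_card hli
    rw [hspan, Fintype.card_fin] at this
    exact this.symm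
  subst hn
  refine ⟨f, hfV, injective_intEval_of_linearIndependent hli, fun g hg => ?_, hspan⟩
  obtain ⟨z, rfl⟩ := hexp g hg
  exact ⟨z, fun b => by simp [Finset.sum_apply]⟩

theorem HasBoundedIntBasisLinf.exists_basis {B : Type} [Fintype B] {V : Submodule ℚ (B → ℚ)} {c : ℕ}
    (hV : HasBoundedIntBasisLinf V c) :
    ∃ u : Fin (Module.finrank ℚ V) → B → ℤ, (∀ j, ratCastVec B (u j) ∈ V) ∧
      Function.Injective (intEval u) ∧ (∀ j b, |u j b| ≤ c) ∧
      Submodule.span ℚ (Set.range fun j => ratCastVec B (u j)) = V := by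
  obtain ⟨s, hs, hspan, hli⟩ := exists_linearIndependent ℚ
    {f : B → ℚ | f ∈ V ∧ IsIntVec f ∧ ∀ b, |f b| ≤ (c : ℚ)}
  rw [show _ = V from hV] at hspan
  have hfin : Finite s := hli.finite
  have := Fintype.ofFinite s
  have hcard : Fintype.card s = Module.finrank ℚ V := by
    have := finrank_span_eq_card hli
    rw [Subtype.range_coe, hspan] at this
    exact this.symm
  let e : Fin (Module.finrank ℚ V) ≃ s := (Fintype.equivFinOfCardEq hcard).symm
  choose u hu using fun j => (hs (e j).2).2.1.exists_ratCastVec_eq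
  have hue : (fun j => ratCastVec B (u j)) = Subtype.val ∘ e := funext hu
  refine ⟨u, fun j => ?_, injective_intEval_of_linearIndependent ?_, fun j b => ?_, ?_⟩
  · rw [hu]; exact (hs (e j).2).1
  · rw [hue]; exact hli.comp e e.injective
  · have := (hs (e j).2).2.2 b
    rw [← hu, ratCastVec_apply] at this
    exact_mod_cast this
  · rw [hue, Set.range_comp, e.range_eq_univ, Set.image_univ, Subtype.range_coe, hspan]

theorem exists_linearMap_intEval_eq {B : Type*} [Fintype B] {d : ℕ} {f u : Fin d → B → ℤ}
    (hu : Function.Injective (intEval u)) (h : ∀ j, ∃ z : Fin d → ℤ, ∀ b, u j b = ∑ i, z i * f i b) :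
    ∃ A : (Fin d → ℝ) →ₗ[ℝ] (Fin d → ℝ), 1 ≤ |LinearMap.det A| ∧
      ∀ t, intEval f (A t) = intEval u t := by
  choose U hU using h
  let M : Matrix (Fin d) (Fin d) ℤ := Matrix.of fun i j => U j i
  let A := Matrix.toLin' (M.map (Int.cast : ℤ → ℝ))
  have hA : ∀ t, intEval f (A t) = intEval u t := by
    intro t
    funext b
    simp only [intEval_apply, hU, A, Matrix.toLin'_apply, Matrix.mulVec, dotProduct, Matrix.map_apply,
      M, Matrix.of_apply]
    push_cast
    simp only [sum_mul, mul_sum]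
    rw [sum_comm]
    exact sum_congr rfl fun j _ => sum_congr rfl fun i _ => by ring
  refine ⟨A, ?_, hA⟩
  have hinj : Function.Injective A := fun s t hst => hu (by rw [← hA, ← hA, hst])
  have hdet : LinearMap.det A = (M.det : ℝ) := by
    rw [LinearMap.det_toLin', ← Int.cast_det]
  have hne : LinearMap.det A ≠ 0 := by
    have := (LinearEquiv.ofInjectiveEndo A hinj).isUnit_det'.ne_zero
    exact this
  rw [hdet] at hne ⊢
  have : M.det ≠ 0 := fun h => hne (by rw [h, Int.cast_zero])
  exact_mod_cast Int.one_le_abs this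

theorem mem_of_forall_mem_perpSet {B : Type} [Fintype B] {V : Submodule ℚ (B → ℚ)} {x : B → ℚ}
    (h : ∀ g ∈ perpSet V, ∑ b, x b * g b = 0) : x ∈ V := by
  classical
  by_contra hx
  obtain ⟨φ, hφ, hV⟩ := Submodule.exists_le_ker_of_notMem hx
  have key : ∀ y, φ y = ∑ b, y b * φ (Pi.single b 1) := φ.apply_eq_sum_mul_single
  refine hφ ?_
  rw [key]
  exact h _ fun y hy => by rw [← key]; exact hV hy

/-- Integer parts of points close to integer vectors lie in `V`. -/
theorem ratCastVec_mem_of_abs_sub_lt {B : Type} [Fintype B] {V : Submodule ℚ (B → ℚ)} {c : ℕ}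
    (hV : PerpHasBoundedIntBasisL1 V c) (hc : 1 ≤ c) {d : ℕ} {f : Fin d → B → ℤ}
    (hf : ∀ i, ratCastVec B (f i) ∈ V) (θ : Fin d → ℝ) (n : B → ℤ)
    (h : ∀ b, |intEval f θ b - n b| < 1 / (2 * c)) : ratCastVec B n ∈ V := by
  have hcR : (1 : ℝ) ≤ c := by exact_mod_cast hc
  refine mem_of_forall_mem_perpSet fun g hg => ?_
  rw [← hV] at hg
  refine Submodule.span_induction (p := fun g _ => ∑ b, ratCastVec B n b * g b = 0) ?_ (by simp) ?_ ?_ hg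
  · rintro g ⟨hgp, hgi, hgc⟩
    obtain ⟨g, rfl⟩ := hgi.exists_ratCastVec_eq
    simp only [ratCastVec_apply] at hgc ⊢
    have h1 : ∀ i, ∑ b, f i b * g b = 0 := fun i => by
      have := hgp _ (hf i)
      simp only [ratCastVec_apply] at this
      exact_mod_cast this
    have h2 : ∑ b, intEval f θ b * (g b : ℝ) = 0 := by
      simp only [intEval_apply, sum_mul]
      rw [sum_comm]
      refine sum_eq_zero fun i _ => ?_
      simp only [mul_assoc, ← mul_sum]
      have : ∑ b, (f i b : ℝ) * (g b : ℝ) = 0 := by exact_mod_cast h1 i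
      rw [this, mul_zero]
    have h3 : |((∑ b, n b * g b : ℤ) : ℝ)| < 1 := by
      have e1 : ((∑ b, n b * g b : ℤ) : ℝ) = -∑ b, (intEval f θ b - n b) * (g b : ℝ) := by
        simp only [sub_mul, sum_sub_distrib, h2]
        push_cast
        ring
      rw [e1, abs_neg]
      calc |∑ b, (intEval f θ b - n b) * (g b : ℝ)|
          ≤ ∑ b, |(intEval f θ b - n b) * (g b : ℝ)| := abs_sum_le_sum_abs _ _
        _ ≤ ∑ b, 1 / (2 * c) * |(g b : ℝ)| := sum_le_sum fun b _ => by
            rw [abs_mul]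
            exact mul_le_mul_of_nonneg_right (h b).le (abs_nonneg _)
        _ = 1 / (2 * c) * ∑ b, |(g b : ℝ)| := by rw [mul_sum]
        _ ≤ 1 / (2 * c) * c := by
            gcongr
            exact_mod_cast hgc
        _ < 1 := by field_simp; norm_num
    have h4 : |∑ b, n b * g b| < 1 := by exact_mod_cast h3
    have h5 := Int.abs_lt_one_iff.1 h4
    exact_mod_cast h5
  · intro x y _ _ hx hy
    simp only [Pi.add_apply, mul_add, sum_add_distrib, hx, hy, add_zero]
  · intro a x _ hx
    simp only [Pi.smul_apply, smul_eq_mul, mul_left_comm _ a, ← mul_sum, hx, mul_zero]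

/-- Every value of a function in `V` at a tuple is a signed combination of the others, for some
index in the tuple. -/
theorem sq_le_of_symmetric {B : Type} [Fintype B] {V : Submodule ℚ (B → ℚ)} {c r : ℕ}
    (hV : HasBoundedIntBasisLinf V c)
    (hsymm : ∀ b₁ b₂ : B, ∃ π : Equiv.Perm B, IsSymmetry V π ∧ π b₁ = b₂)
    (hr : (2 * r * c + 1) ^ Module.finrank ℚ V < 2 ^ r) (w : B → ℝ) (hw0 : ∀ b, 0 ≤ w b)
    (hw : ∀ (t : Fin r → B) (ε : Fin r → ℤ) (i : Fin r), (∀ j, |ε j| ≤ 1) → ε i ≠ 0 →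
      (∀ f ∈ V, ∑ j, (ε j : ℚ) * f (t j) = 0) → w (t i) ≤ ∑ j ∈ univ.erase i, w (t j)) (b : B) :
    w b ^ 2 ≤ (r : ℝ) ^ 3 / Fintype.card B * ∑ x, w x ^ 2 := by
  refine sq_le_of_relations
    (fun t i => ∃ ε : Fin r → ℤ, (∀ j, |ε j| ≤ 1) ∧ ε i ≠ 0 ∧ ∀ f ∈ V, ∑ j, (ε j : ℚ) * f (t j) = 0)
    (fun t => ?_) (fun b b' => ?_) w hw0 (fun t i ⟨ε, h1, h2, h3⟩ => hw t ε i h1 h2 h3) b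
  · obtain ⟨u, -, -, huc, hspan⟩ := hV.exists_basis
    obtain ⟨ε, h1, ⟨i, hi⟩, h3⟩ := exists_signed_relation hr (fun i j => u j (t i))
      (fun i j => huc j (t i))
    refine ⟨i, ε, h1, hi, fun f hf => ?_⟩
    rw [← hspan] at hf
    refine Submodule.span_induction (p := fun f _ => ∑ j, (ε j : ℚ) * f (t j) = 0) ?_ (by simp)
      ?_ ?_ hf
    · rintro _ ⟨j, rfl⟩
      simp only [ratCastVec_apply]
      exact_mod_cast h3 j
    · intro x y _ _ hx hy
      simp only [Pi.add_apply, mul_add, sum_add_distrib, hx, hy, add_zero]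
    · intro a x _ hx
      simp only [Pi.smul_apply, smul_eq_mul, mul_left_comm _ a, ← mul_sum, hx, mul_zero]
  · obtain ⟨π, hπ, hb⟩ := hsymm b b'
    refine ⟨π, hb, fun t i ⟨ε, h1, h2, h3⟩ => ⟨ε, h1, h2, fun f hf => ?_⟩⟩
    exact h3 _ (hπ f hf)

theorem eq_neg_mul_sum_erase {ι : Type*} [Fintype ι] [DecidableEq ι] {ε : ι → ℤ} {i : ι}
    (hε : |ε i| ≤ 1) (hi : ε i ≠ 0) {x : ι → ℝ} (h : ∑ j, (ε j : ℝ) * x j = 0) :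
    x i = -(ε i * ∑ j ∈ univ.erase i, (ε j : ℝ) * x j) := by
  rw [← add_sum_erase _ _ (mem_univ i)] at h
  have h1 : ε i * ε i = 1 := by
    have := abs_le.1 hε
    obtain h | h : ε i = 1 ∨ ε i = -1 := by omega
    all_goals rw [h]; norm_num
  have h2 : (ε i : ℝ) * ε i = 1 := by exact_mod_cast h1
  linear_combination (ε i : ℝ) * h - x i * h2

theorem sum_intEval_eq_zero {B : Type} [Fintype B] {V : Submodule ℚ (B → ℚ)} {d r : ℕ}
    {f : Fin d → B → ℤ} (hf : ∀ i, ratCastVec B (f i) ∈ V) {t : Fin r → B} {ε : Fin r → ℤ}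
    (h : ∀ f ∈ V, ∑ j, (ε j : ℚ) * f (t j) = 0) (θ : Fin d → ℝ) :
    ∑ j, (ε j : ℝ) * intEval f θ (t j) = 0 := by
  simp only [intEval_apply, mul_sum]
  rw [sum_comm]
  refine sum_eq_zero fun i _ => ?_
  have h1 := h _ (hf i)
  simp only [ratCastVec_apply] at h1
  have h2 : ∑ j, (ε j : ℝ) * (f i (t j) : ℝ) = 0 := by exact_mod_cast h1
  simp only [mul_left_comm _ (θ i), ← mul_sum, h2, mul_zero]

theorem abs_mul_sum_mul_le {ι : Type*} (s : Finset ι) {e : ℤ} {ε : ι → ℤ} (he : |e| ≤ 1)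
    (hε : ∀ j, |ε j| ≤ 1) (x : ι → ℝ) :
    |(e : ℝ) * ∑ j ∈ s, (ε j : ℝ) * x j| ≤ ∑ j ∈ s, |x j| := by
  have he' : |(e : ℝ)| ≤ 1 := by exact_mod_cast he
  rw [abs_mul]
  refine (mul_le_of_le_one_left (abs_nonneg _) he').trans ((abs_sum_le_sum_abs _ _).trans ?_)
  refine sum_le_sum fun j _ => ?_
  rw [abs_mul]
  exact mul_le_of_le_one_left (abs_nonneg _) (by exact_mod_cast hε j)

theorem abs_intEval_sq_le {B : Type} [Fintype B] {V : Submodule ℚ (B → ℚ)} {c r : ℕ}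
    (hV : HasBoundedIntBasisLinf V c)
    (hsymm : ∀ b₁ b₂ : B, ∃ π : Equiv.Perm B, IsSymmetry V π ∧ π b₁ = b₂)
    (hr : (2 * r * c + 1) ^ Module.finrank ℚ V < 2 ^ r) {d : ℕ} {f : Fin d → B → ℤ}
    (hf : ∀ i, ratCastVec B (f i) ∈ V) (θ : Fin d → ℝ) (b : B) :
    |intEval f θ b| ^ 2 ≤ (r : ℝ) ^ 3 / Fintype.card B * ∑ x, intEval f θ x ^ 2 := by
  refine (sq_le_of_symmetric hV hsymm hr (fun b => |intEval f θ b|) (fun _ => abs_nonneg _)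
    (fun t ε i h1 h2 h3 => ?_) b).trans (by simp only [sq_abs, le_refl])
  rw [eq_neg_mul_sum_erase (x := fun j => intEval f θ (t j)) (h1 i) h2
    (sum_intEval_eq_zero hf h3 θ), abs_neg]
  exact abs_mul_sum_mul_le _ (h1 i) h1 _

theorem abs_intEval_sub_round_sq_le {B : Type} [Fintype B] {V : Submodule ℚ (B → ℚ)} {c r : ℕ}
    (hV : HasBoundedIntBasisLinf V c)
    (hsymm : ∀ b₁ b₂ : B, ∃ π : Equiv.Perm B, IsSymmetry V π ∧ π b₁ = b₂)
    (hr : (2 * r * c + 1) ^ Module.finrank ℚ V < 2 ^ r) {d : ℕ} {f : Fin d → B → ℤ}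
    (hf : ∀ i, ratCastVec B (f i) ∈ V) (θ : Fin d → ℝ) (b : B) :
    |intEval f θ b - round (intEval f θ b)| ^ 2 ≤ (r : ℝ) ^ 3 / Fintype.card B *
      ∑ x, (intEval f θ x - round (intEval f θ x)) ^ 2 := by
  refine (sq_le_of_symmetric hV hsymm hr (fun b => |intEval f θ b - round (intEval f θ b)|)
    (fun _ => abs_nonneg _) (fun t ε i h1 h2 h3 => ?_) b).trans (by simp only [sq_abs, le_refl])
  refine (round_le _ (-(ε i * ∑ j ∈ univ.erase i, ε j * round (intEval f θ (t j))))).trans ?_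
  have h4 : intEval f θ (t i) - ((-(ε i * ∑ j ∈ univ.erase i, ε j * round (intEval f θ (t j))) : ℤ) : ℝ)
      = -(ε i * ∑ j ∈ univ.erase i, (ε j : ℝ) * (intEval f θ (t j) - round (intEval f θ (t j)))) := by
    rw [eq_neg_mul_sum_erase (x := fun j => intEval f θ (t j)) (h1 i) h2
      (sum_intEval_eq_zero hf h3 θ)]
    simp only [mul_sub, sum_sub_distrib]
    push_cast
    ring
  rw [h4, abs_neg]
  exact abs_mul_sum_mul_le _ (h1 i) h1 _

end

section
open Finset

theorem one_add_log_pow_four_le {x : ℝ} (hx : 1 ≤ x) : (1 + Real.log x) ^ 4 ≤ 256 * x := by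
  have hx0 : 0 < x := by linarith
  have h0 := Real.log_nonneg hx
  have h1 : 1 + Real.log x ≤ 4 * Real.exp (Real.log x / 4) := by
    have := Real.add_one_le_exp (Real.log x / 4)
    linarith
  calc (1 + Real.log x) ^ 4 ≤ (4 * Real.exp (Real.log x / 4)) ^ 4 := by gcongr
    _ = 256 * Real.exp (Real.log x / 4) ^ 4 := by ring
    _ = 256 * x := by
      rw [← Real.exp_nat_mul]
      congr 1
      rw [show ((4 : ℕ) : ℝ) * (Real.log x / 4) = Real.log x by push_cast; ring, Real.exp_log hx0]

theorem log_mul_pow_four_le {x y : ℝ} (hx : 1 ≤ x) (hy : 2 ≤ y) :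
    Real.log (x * y) ^ 4 ≤ 2560 * (x * Real.log y ^ 6) := by
  have h2 := Real.log_two_gt_d9
  have hL : Real.log 2 ≤ Real.log y := Real.log_le_log (by norm_num) hy
  have hlx := Real.log_nonneg hx
  set L := Real.log y
  have hL' : 0.69 ≤ L := by linarith
  have h1 : 0.69 * Real.log (x * y) ≤ L * (1 + Real.log x) := by
    rw [Real.log_mul (by linarith) (by linarith)]
    nlinarith
  have h0 : 0 ≤ Real.log (x * y) := Real.log_nonneg (by nlinarith)
  have h3 : (0.69 * Real.log (x * y)) ^ 4 ≤ (L * (1 + Real.log x)) ^ 4 := by gcongr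
  have h4 : (L * (1 + Real.log x)) ^ 4 ≤ L ^ 4 * (256 * x) := by
    rw [mul_pow]
    have := one_add_log_pow_four_le hx
    gcongr
  have h5 : (0.69 : ℝ) ^ 2 * L ^ 4 ≤ L ^ 6 := by
    have : (0.69 : ℝ) ^ 2 ≤ L ^ 2 := by gcongr
    calc (0.69 : ℝ) ^ 2 * L ^ 4 ≤ L ^ 2 * L ^ 4 := by gcongr
      _ = L ^ 6 := by ring
  have h6 : (0.69 : ℝ) ^ 2 * L ^ 4 * x ≤ L ^ 6 * x := by gcongr
  rw [mul_pow] at h3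
  have h7 : 0 ≤ L ^ 6 * x := by positivity
  norm_num at h3 h6
  nlinarith

theorem exists_pow_lt_two_pow {d c : ℕ} {l : ℝ} (hd : 1 ≤ d) (hc : 1 ≤ c) (hl0 : 1 / 2 ≤ l)
    (hl : Real.log (2 * c * d) ≤ l) :
    ∃ r : ℕ, (2 * r * c + 1) ^ d < 2 ^ r ∧ (r : ℝ) ≤ 18 * (d * l) := by
  have hdR : (1 : ℝ) ≤ d := by exact_mod_cast hd
  have hcR : (1 : ℝ) ≤ c := by exact_mod_cast hc
  have hdl : 1 / 2 ≤ d * l := by nlinarith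
  refine ⟨⌈16 * (d * l)⌉₊, ?_, ?_⟩
  swap
  · have := Nat.ceil_lt_add_one (show 0 ≤ 16 * (d * l) by linarith)
    linarith
  set r := ⌈16 * (d * l)⌉₊
  have hr : 16 * (d * l) ≤ r := Nat.le_ceil _
  have hrR : (1 : ℝ) ≤ r := by linarith
  set s : ℝ := r / d with hs
  have hsr : (r : ℝ) = s * d := by rw [hs]; field_simp
  have hs16 : 16 * l ≤ s := by rw [hs, le_div_iff₀ (by linarith)]; linarith
  have hs0 : 0 < s := by linarith
  have hlog2 := Real.log_two_gt_d9
  have hlog2' := Real.log_two_lt_d9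
  have hlogs : Real.log s ≤ s / 2 := by
    have h1 := Real.log_le_sub_one_of_pos (show 0 < s / 2 by linarith)
    rw [Real.log_div hs0.ne' two_ne_zero] at h1
    linarith
  have h1 : (2 * r * c + 1 : ℝ) ≤ 3 / 2 * (2 * c * d) * s := by
    calc (2 * r * c + 1 : ℝ) ≤ 3 * (r * c) := by nlinarith
      _ = _ := by rw [hsr]; ring
  have h2 : Real.log (2 * r * c + 1) < s * Real.log 2 := by
    calc Real.log (2 * r * c + 1) ≤ Real.log (3 / 2 * (2 * c * d) * s) :=
          Real.log_le_log (by positivity) h1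
      _ = Real.log (3 / 2) + Real.log (2 * c * d) + Real.log s := by
          rw [Real.log_mul (by positivity) hs0.ne', Real.log_mul (by norm_num) (by positivity)]
      _ ≤ 1 / 2 + l + s / 2 := by
          have := Real.log_le_sub_one_of_pos (show (0 : ℝ) < 3 / 2 by norm_num)
          linarith
      _ < s * Real.log 2 := by nlinarith
  have h3 : Real.log ((2 * r * c + 1) ^ d) < Real.log (2 ^ r) := by
    rw [Real.log_pow, Real.log_pow]
    calc (d : ℝ) * Real.log (2 * r * c + 1) < d * (s * Real.log 2) := by gcongr
      _ = r * Real.log 2 := by rw [hsr]; ring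
  have h4 := (Real.log_lt_log_iff (by positivity) (by positivity)).1 h3
  exact_mod_cast h4

theorem pow_mul_log_le {D l X : ℝ} (hD : 1 ≤ D) (hl : 1 / 2 ≤ l)
    (hX : 10 ^ 12 * (D ^ 6 * l ^ 4) ≤ X) :
    6000 * (D ^ 4 * l ^ 3) * (57 * l + Real.log X) < X := by
  have hl0 : 0 < l := by linarith
  have hX0 : 0 < X := lt_of_lt_of_le (by positivity) hX
  set y := Real.sqrt (Real.sqrt X) with hy
  have hy2 : y ^ 2 = Real.sqrt X := Real.sq_sqrt (Real.sqrt_nonneg _)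
  have hy4 : y ^ 4 = X := by
    rw [show y ^ 4 = (y ^ 2) ^ 2 by ring, hy2, Real.sq_sqrt hX0.le]
  have hy0 : 0 < y := Real.sqrt_pos.2 (Real.sqrt_pos.2 hX0)
  have h1 : 10 ^ 6 * (D ^ 3 * l ^ 2) ≤ y ^ 2 := by
    refine le_of_sq_le_sq ?_ (by positivity)
    calc (10 ^ 6 * (D ^ 3 * l ^ 2)) ^ 2 = 10 ^ 12 * (D ^ 6 * l ^ 4) := by ring
      _ ≤ y ^ 4 := by rw [hy4]; exact hX
      _ = (y ^ 2) ^ 2 := by ring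
  have h2 : 10 ^ 3 * (D * l) ≤ y := by
    refine le_of_sq_le_sq ?_ hy0.le
    calc (10 ^ 3 * (D * l)) ^ 2 = 10 ^ 6 * (D ^ 2 * l ^ 2) := by ring
      _ ≤ 10 ^ 6 * (D ^ 3 * l ^ 2) := by gcongr; norm_num
      _ ≤ y ^ 2 := h1
  have h3 : 10 ^ 9 * (D ^ 4 * l ^ 3) ≤ y ^ 3 := by
    calc 10 ^ 9 * (D ^ 4 * l ^ 3) = 10 ^ 6 * (D ^ 3 * l ^ 2) * (10 ^ 3 * (D * l)) := by ring
      _ ≤ y ^ 2 * y := by gcongr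
      _ = y ^ 3 := by ring
  have h4 : Real.log X ≤ 4 * y := by
    rw [← hy4, Real.log_pow]
    have := Real.log_le_sub_one_of_pos hy0
    push_cast
    linarith
  have h5 : D ^ 4 * l ^ 3 * Real.log X ≤ 4 / 10 ^ 9 * X := by
    calc D ^ 4 * l ^ 3 * Real.log X ≤ D ^ 4 * l ^ 3 * (4 * y) := by gcongr
      _ ≤ y ^ 3 / 10 ^ 9 * (4 * y) := by
        gcongr
        rw [le_div_iff₀ (by positivity)]
        linarith
      _ = 4 / 10 ^ 9 * X := by rw [← hy4]; ring
  have h6 : D ^ 4 * l ^ 4 ≤ X / 10 ^ 12 := by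
    rw [le_div_iff₀ (by positivity)]
    calc D ^ 4 * l ^ 4 * 10 ^ 12 ≤ 10 ^ 12 * (D ^ 6 * l ^ 4) := by
          rw [mul_comm]
          gcongr
          norm_num
      _ ≤ X := hX
  calc 6000 * (D ^ 4 * l ^ 3) * (57 * l + Real.log X)
      = 342000 * (D ^ 4 * l ^ 4) + 6000 * (D ^ 4 * l ^ 3 * Real.log X) := by ring
    _ ≤ 342000 * (X / 10 ^ 12) + 6000 * (4 / 10 ^ 9 * X) := by gcongr
    _ < X := by linarith

theorem exists_relation_length {d c₂ c₃ : ℕ} (hd : 1 ≤ d) (hc₂ : 1 ≤ c₂) (hc₃ : 1 ≤ c₃) {m : ℝ}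
    (hm : 10 ^ 16 * c₂ * (c₃ : ℝ) ^ 2 * (d : ℝ) ^ 6 * Real.log (2 * c₃ * d) ^ 6 ≤ m) :
    ∃ r : ℕ, (2 * r * c₂ + 1) ^ d < 2 ^ r ∧ 8 * (r : ℝ) ^ 3 * d * (c₃ : ℝ) ^ 2 < m ∧
      2 * 10 ^ 7 * (r : ℝ) ^ 3 * (d : ℝ) ^ 3 ≤ m ∧
      25 + Real.log 4 + d * Real.log (d * c₂ * m) < m / ((c₃ : ℝ) ^ 2 * (r : ℝ) ^ 3) := by
  have hD : (1 : ℝ) ≤ d := by exact_mod_cast hd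
  have h2R : (1 : ℝ) ≤ c₂ := by exact_mod_cast hc₂
  have h3R : (1 : ℝ) ≤ c₃ := by exact_mod_cast hc₃
  set D := (d : ℝ)
  have hlog2 := Real.log_two_gt_d9
  have hy : 2 ≤ 2 * (c₃ : ℝ) * D := by nlinarith
  set l := Real.log (c₂ * (2 * c₃ * D)) with hl
  have hle : ∀ {x : ℝ}, 0 < x → x ≤ c₂ * (2 * c₃ * D) → Real.log x ≤ l := Real.log_le_log
  have hl0 : 1 / 2 ≤ l := by
    have := hle two_pos (by nlinarith)
    linarith
  have hl00 : 0 < l := by linarith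
  obtain ⟨r, hr, hr18⟩ := exists_pow_lt_two_pow hd hc₂ hl0 (hle (by positivity)
    (by calc 2 * (c₂ : ℝ) * d = c₂ * (2 * 1 * D) := by ring
          _ ≤ _ := by gcongr))
  have hr0 : 0 < r := by
    rcases Nat.eq_zero_or_pos r with h | h
    · rw [h] at hr; simp at hr
    · exact h
  have hrR : (0 : ℝ) < r := by exact_mod_cast hr0
  have hr3 : (r : ℝ) ^ 3 ≤ 6000 * (D ^ 3 * l ^ 3) := by
    calc (r : ℝ) ^ 3 ≤ (18 * (D * l)) ^ 3 := by gcongr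
      _ = 5832 * (D ^ 3 * l ^ 3) := by ring
      _ ≤ _ := by gcongr; norm_num
  set X := m / (c₃ : ℝ) ^ 2 with hXdef
  have hmX : m = X * (c₃ : ℝ) ^ 2 := by rw [hXdef]; field_simp
  have hX : 10 ^ 12 * (D ^ 6 * l ^ 4) ≤ X := by
    have h1 := log_mul_pow_four_le h2R hy
    rw [hXdef, le_div_iff₀ (by positivity)]
    refine le_trans ?_ hm
    calc 10 ^ 12 * (D ^ 6 * l ^ 4) * (c₃ : ℝ) ^ 2
        ≤ 10 ^ 12 * (D ^ 6 * (2560 * (c₂ * Real.log (2 * c₃ * D) ^ 6))) * (c₃ : ℝ) ^ 2 := by gcongr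
      _ = 2560 * 10 ^ 12 * (c₂ * (c₃ : ℝ) ^ 2 * D ^ 6 * Real.log (2 * c₃ * D) ^ 6) := by ring
      _ ≤ 10 ^ 16 * (c₂ * (c₃ : ℝ) ^ 2 * D ^ 6 * Real.log (2 * c₃ * D) ^ 6) := by
        have : 0 ≤ Real.log (2 * c₃ * D) := Real.log_nonneg (by linarith)
        gcongr
        norm_num
      _ = _ := by ring
  have hX6 : 10 ^ 11 * 5 * (D ^ 6 * l ^ 3) ≤ X := by
    refine le_trans ?_ hX
    have : 0 ≤ D ^ 6 * l ^ 3 := by positivity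
    calc 10 ^ 11 * 5 * (D ^ 6 * l ^ 3) = 10 ^ 12 * (D ^ 6 * l ^ 3) * (1 / 2) := by ring
      _ ≤ 10 ^ 12 * (D ^ 6 * l ^ 3) * l := by gcongr
      _ = _ := by ring
  have hX0 : 0 < X := lt_of_lt_of_le (by positivity) hX
  have hXm : X ≤ m := by
    rw [hmX]
    exact le_mul_of_one_le_right hX0.le (one_le_pow₀ h3R)
  refine ⟨r, hr, ?_, ?_, ?_⟩
  · rw [hmX]
    gcongr
    calc 8 * (r : ℝ) ^ 3 * D ≤ 8 * (6000 * (D ^ 3 * l ^ 3)) * D := by gcongr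
      _ = 48000 * (D ^ 4 * l ^ 3) := by ring
      _ < 10 ^ 11 * 5 * (D ^ 4 * l ^ 3) := by gcongr; norm_num
      _ ≤ 10 ^ 11 * 5 * (D ^ 6 * l ^ 3) := by gcongr; norm_num
      _ ≤ X := hX6
  · refine le_trans ?_ hXm
    calc 2 * 10 ^ 7 * (r : ℝ) ^ 3 * D ^ 3 ≤ 2 * 10 ^ 7 * (6000 * (D ^ 3 * l ^ 3)) * D ^ 3 := by gcongr
      _ = 120000000000 * (D ^ 6 * l ^ 3) := by ring
      _ ≤ 10 ^ 11 * 5 * (D ^ 6 * l ^ 3) := by gcongr; norm_num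
      _ ≤ X := hX6
  · have hm0 : 0 < m := by linarith
    rw [← div_div, ← hXdef, lt_div_iff₀ (by positivity)]
    have hlogm : Real.log (D * c₂ * m) ≤ 3 * l + Real.log X := by
      rw [hmX, Real.log_mul (by positivity) (by positivity),
        Real.log_mul (by positivity) (by positivity), Real.log_mul hX0.ne' (by positivity),
        Real.log_pow]
      have e1 := hle (show 0 < D * c₂ by positivity)
        (by calc D * c₂ = c₂ * (1 * 1 * D) := by ring
              _ ≤ _ := by gcongr; norm_num)
      rw [Real.log_mul (by positivity) (by positivity)] at e1
      have e2 := hle (show (0 : ℝ) < c₃ by positivity)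
        (by calc (c₃ : ℝ) = 1 * (1 * c₃ * 1) := by ring
              _ ≤ _ := by gcongr; norm_num)
      push_cast
      linarith
    have hlog4 : Real.log 4 ≤ 2 := by
      have := Real.log_two_lt_d9
      rw [show (4 : ℝ) = 2 ^ 2 by norm_num, Real.log_pow]
      push_cast
      linarith
    have hDl : 1 / 2 ≤ D * l := by nlinarith
    have hX1 : 0 ≤ Real.log X := by
      refine Real.log_nonneg ?_
      refine le_trans ?_ hX
      calc (1 : ℝ) ≤ 10 ^ 12 * (1 ^ 6 * (1 / 2) ^ 4) := by norm_num
        _ ≤ _ := by gcongr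
    calc (25 + Real.log 4 + D * Real.log (D * c₂ * m)) * (r : ℝ) ^ 3
        ≤ (D * (57 * l + Real.log X)) * (r : ℝ) ^ 3 := by
          gcongr
          nlinarith
      _ ≤ (D * (57 * l + Real.log X)) * (6000 * (D ^ 3 * l ^ 3)) := by gcongr
      _ = 6000 * (D ^ 4 * l ^ 3) * (57 * l + Real.log X) := by ring
      _ < X := pow_mul_log_le hD hl0 hX

end

section
open Finset

theorem half_min_le_mul_div_add {a b : ℝ} (ha : 0 < a) (hb : 0 < b) :
    min a b / 2 ≤ a * b / (a + b) ∧ a * b / (a + b) ≤ min a b := by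
  rw [le_div_iff₀ (by positivity), div_le_iff₀ (by positivity)]
  rcases le_total a b with h | h
  · rw [min_eq_left h]
    constructor <;> nlinarith
  · rw [min_eq_right h]
    constructor <;> nlinarith

theorem intEval_sq_le {B : Type*} [Fintype B] {d c : ℕ} {u : Fin d → B → ℤ} (hu : ∀ j b, |u j b| ≤ c)
    {ρ : ℝ} {t : Fin d → ℝ} (ht : ∀ i, t i ∈ Set.Icc 0 ρ) (b : B) :
    intEval u t b ^ 2 ≤ (d * ρ * c) ^ 2 := by
  rw [← sq_abs]
  gcongr
  rw [intEval_apply]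
  calc |∑ i, t i * (u i b : ℝ)| ≤ ∑ i, |t i * (u i b : ℝ)| := abs_sum_le_sum_abs _ _
    _ ≤ ∑ _i : Fin d, ρ * c := by
      refine sum_le_sum fun i _ => ?_
      rw [abs_mul, abs_of_nonneg (ht i).1]
      have h1 : |(u i b : ℝ)| ≤ c := by exact_mod_cast hu i b
      exact mul_le_mul (ht i).2 h1 (abs_nonneg _) ((ht i).1.trans (ht i).2)
    _ = d * ρ * c := by simp [mul_assoc]

theorem exists_subset_sum_eq_of_length {B : Type} [Fintype B] {V : Submodule ℚ (B → ℚ)}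
    {c₂ c₃ r N : ℕ} (hd : 0 < Module.finrank ℚ V) (hc₂ : 1 ≤ c₂) (hc₃ : 1 ≤ c₃)
    (h₂ : HasBoundedIntBasisLinf V c₂) (h₃ : PerpHasBoundedIntBasisL1 V c₃)
    (hsymm : ∀ b₁ b₂ : B, ∃ π : Equiv.Perm B, IsSymmetry V π ∧ π b₁ = b₂)
    {γ : B → ℤ} (hγ : ∀ f ∈ V, ∑ b, (γ b : ℚ) * f b = (N : ℚ) / (Fintype.card B : ℚ) * ∑ b, f b)
    (hN0 : 0 < N) (hNB : N < Fintype.card B) {m : ℝ}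
    (hm : m = min (N : ℝ) ((Fintype.card B : ℝ) - N))
    (hr : (2 * r * c₂ + 1) ^ Module.finrank ℚ V < 2 ^ r)
    (h1 : 8 * (r : ℝ) ^ 3 * Module.finrank ℚ V * (c₃ : ℝ) ^ 2 < m)
    (h2 : 2 * 10 ^ 7 * (r : ℝ) ^ 3 * (Module.finrank ℚ V : ℝ) ^ 3 ≤ m)
    (h3 : 25 + Real.log 4 + Module.finrank ℚ V * Real.log (Module.finrank ℚ V * c₂ * m) <
      m / ((c₃ : ℝ) ^ 2 * (r : ℝ) ^ 3)) :
    ∃ T : Finset B, ∀ f ∈ V, ∑ b ∈ T, f b = (N : ℚ) / (Fintype.card B : ℚ) * ∑ b, f b := by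
  obtain ⟨f, hfV, hfinj, hfint, hfspan⟩ := exists_integral_basis (V := V) (by
    refine le_antisymm (Submodule.span_le.2 fun _ h => h.1) ?_
    conv_lhs => rw [← show _ = V from h₂]
    exact Submodule.span_mono fun _ h => ⟨h.1, h.2.1⟩)
  obtain ⟨u, huV, huinj, huc, -⟩ := h₂.exists_basis
  obtain ⟨A, hdet, hA⟩ := exists_linearMap_intEval_eq (f := f) huinj fun j => hfint _ (huV j)
  set n := Fintype.card B with hn
  have hdR : (1 : ℝ) ≤ Module.finrank ℚ V := by exact_mod_cast hd
  have hc₂R : (1 : ℝ) ≤ c₂ := by exact_mod_cast hc₂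
  have hc₃R : (1 : ℝ) ≤ c₃ := by exact_mod_cast hc₃
  have hNR : (1 : ℝ) ≤ N := by exact_mod_cast hN0
  have hNB' : (N : ℝ) + 1 ≤ n := by exact_mod_cast hNB
  have hn0 : (0 : ℝ) < n := by linarith
  have hr0 : 0 < r := by
    rcases Nat.eq_zero_or_pos r with h | h
    · rw [h] at hr; simp at hr
    · exact h
  have hrR : (0 : ℝ) < r := by exact_mod_cast hr0
  have hm1 : 1 ≤ m := by rw [hm]; exact le_min hNR (by linarith)
  set p : ℝ := (N : ℝ) / n with hp
  have hp0 : 0 < p := by positivity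
  have hp1 : p < 1 := by rw [hp, div_lt_one hn0]; linarith
  obtain ⟨hσ1, hσ2⟩ := half_min_le_mul_div_add (a := N) (b := (n : ℝ) - N) (by linarith) (by linarith)
  rw [← hm] at hσ1 hσ2
  have hσ : (N : ℝ) * (n - N) / (N + (n - N)) = p * (1 - p) * n := by
    rw [hp, add_sub_cancel]
    field_simp
  rw [hσ] at hσ1 hσ2
  have ha : ∀ i, ((∑ b, γ b * f i b : ℤ) : ℝ) = p * ∑ b, (f i b : ℝ) := by
    intro i
    have := congrArg (Rat.cast : ℚ → ℝ) (hγ _ (hfV i))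
    simpa using this
  obtain ⟨T, hT⟩ := exists_subset_sum_eq_of_fourier_bounds hd f hp0 hp1 ha hfinj
    (δ := 1 / (2 * c₃)) (κ := (r : ℝ) ^ 3 / n) (ρ := 1 / (Module.finrank ℚ V * c₂ * m)) (by gcongr; linarith)
    (by positivity) (by positivity)
    (by
      intro θ hθ
      obtain ⟨z, hz⟩ := hfint _ (ratCastVec_mem_of_abs_sub_lt h₃ hc₃ hfV θ _ hθ)
      refine ⟨fun i => -z i, fun b => ?_⟩
      have : intEval f (fun i => ((-z i : ℤ) : ℝ) + θ i) b = intEval f θ b - round (intEval f θ b) := by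
        rw [hz b]
        simp only [intEval_apply]
        push_cast
        simp only [add_mul, sum_add_distrib, neg_mul, sum_neg_distrib]
        ring
      rw [this]
      exact hθ b)
    (abs_intEval_sq_le h₂ hsymm hr hfV) (abs_intEval_sub_round_sq_le h₂ hsymm hr hfV)
    (by positivity) A hdet
    (by
      intro t ht
      have hσ0 : 0 ≤ p * (1 - p) := mul_nonneg hp0.le (by linarith)
      rw [hA]
      calc p * (1 - p) * ∑ b, intEval u t b ^ 2
          ≤ p * (1 - p) * ∑ _b : B,
              (Module.finrank ℚ V * (1 / (Module.finrank ℚ V * c₂ * m)) * c₂) ^ 2 := by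
            exact mul_le_mul_of_nonneg_left (sum_le_sum fun b _ => intEval_sq_le huc ht b) hσ0
        _ = p * (1 - p) * n * (1 / m) ^ 2 := by
            have : Module.finrank ℚ V * (1 / (Module.finrank ℚ V * c₂ * m)) * c₂ = 1 / m := by
              field_simp
            rw [sum_const, card_univ, nsmul_eq_mul, this, mul_assoc (p * (1 - p))]
        _ ≤ m * (1 / m) ^ 2 := by gcongr
        _ = 1 / m := by field_simp
        _ ≤ 1 := by rw [div_le_one (by linarith)]; exact hm1)
    (by
      rw [div_mul_eq_mul_div, div_lt_iff₀ hn0, mul_right_comm, div_pow, one_pow, mul_one_div,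
        lt_div_iff₀ (by positivity)]
      linarith)
    (by
      rw [mul_div_assoc', div_mul_eq_mul_div, div_le_iff₀ hn0]
      linarith)
    (by
      have hρ : (1 / (Module.finrank ℚ V * c₂ * m)) ^ Module.finrank ℚ V =
          Real.exp (-(Module.finrank ℚ V * Real.log (Module.finrank ℚ V * c₂ * m))) := by
        rw [Real.exp_neg, Real.exp_nat_mul, Real.exp_log (by positivity), one_div, inv_pow]
      rw [hρ, ← Real.exp_log (show (0 : ℝ) < 4 by norm_num), ← Real.exp_add, ← Real.exp_sub,
        Real.exp_lt_exp]
      have : m / ((c₃ : ℝ) ^ 2 * (r : ℝ) ^ 3)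
          ≤ 8 * (p * (1 - p)) * (1 / (2 * c₃)) ^ 2 / ((r : ℝ) ^ 3 / n) := by
        calc m / ((c₃ : ℝ) ^ 2 * (r : ℝ) ^ 3)
            ≤ 2 * (p * (1 - p) * n) / ((c₃ : ℝ) ^ 2 * (r : ℝ) ^ 3) := by
              gcongr
              linarith
          _ = _ := by
              field_simp
              ring
      linarith)
  refine ⟨T, fun g hg => ?_⟩
  rw [← hγ g hg]
  rw [← hfspan] at hg
  refine Submodule.span_induction (p := fun g _ => ∑ b ∈ T, g b = ∑ b, (γ b : ℚ) * g b) ?_ (by simp)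
    ?_ ?_ hg
  · rintro _ ⟨i, rfl⟩
    simp only [ratCastVec_apply]
    exact_mod_cast hT i
  · intro x y _ _ hx hy
    simp only [Pi.add_apply, mul_add, sum_add_distrib, hx, hy]
  · intro a x _ hx
    simp only [Pi.smul_apply, smul_eq_mul, mul_left_comm _ a, ← mul_sum, hx]

end

/-- Main theorem: under divisibility, boundedness, symmetry and constant-functions
assumptions, every multiple `N` of `c₁` with `min(N,|B|−N) ≥ C·c₂·c₃²·dim(V)⁶·log(2c₃dim(V))⁶`
is the size of a subset `T ⊆ B` averaging every `f ∈ V` exactly as `B` does. -/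
theorem main_theorem_existence :
    ∃ C : ℝ, 0 < C ∧
      ∀ (B : Type) [Fintype B] (V : Submodule ℚ (B → ℚ)) (c₁ c₂ c₃ : ℕ),
        1 ≤ c₁ → 1 ≤ c₂ → 1 ≤ c₃ →
        IsDivisibilityConstant V c₁ →
        HasBoundedIntBasisLinf V c₂ →
        PerpHasBoundedIntBasisL1 V c₃ →
        (∀ b₁ b₂ : B, ∃ π : Equiv.Perm B, IsSymmetry V π ∧ π b₁ = b₂) →
        (fun _ => (1 : ℚ)) ∈ V →
        ∀ N : ℕ, c₁ ∣ N →
          C * c₂ * (c₃ : ℝ) ^ 2 * (Module.finrank ℚ V : ℝ) ^ 6 *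
              (Real.log (2 * c₃ * (Module.finrank ℚ V : ℝ))) ^ 6
            ≤ min (N : ℝ) ((Fintype.card B : ℝ) - N) →
          ∃ T : Finset B, T.card = N ∧
            ∀ f ∈ V, ((T.card : ℚ))⁻¹ * ∑ x ∈ T, f x
              = ((Fintype.card B : ℚ))⁻¹ * ∑ b, f b := by
  refine ⟨10 ^ 16, by norm_num, ?_⟩
  intro B _ V c₁ c₂ c₃ _ hc₂ hc₃ h₁ h₂ h₃ hsymm hone N hN hbound
  cases isEmpty_or_nonempty B with
  | inl hB =>
    have hsub : Subsingleton V := ⟨fun x y => Subtype.ext (Subsingleton.elim _ _)⟩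
    rw [Module.finrank_zero_of_subsingleton] at hbound
    have hle := (le_min_iff.1 hbound).2
    rw [Fintype.card_eq_zero] at hle
    norm_num at hle
    subst hle
    exact ⟨∅, rfl, fun f _ => by simp⟩
  | inr hB =>
    have hne : Nontrivial V := by
      refine ⟨⟨⟨_, hone⟩, 0, fun h => ?_⟩⟩
      exact one_ne_zero (congrFun (congrArg Subtype.val h) (Classical.arbitrary B))
    have hd : 0 < Module.finrank ℚ V := Module.finrank_pos
    have hlog : 0 < Real.log (2 * c₃ * (Module.finrank ℚ V : ℝ)) := by
      have h3 : (1 : ℝ) ≤ c₃ := by exact_mod_cast hc₃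
      have h4 : (1 : ℝ) ≤ Module.finrank ℚ V := by exact_mod_cast hd
      exact Real.log_pos (by nlinarith)
    have hpos := lt_of_lt_of_le (by positivity) hbound
    obtain ⟨hN0, hNB⟩ := lt_min_iff.1 hpos
    have hN0' : 0 < N := by exact_mod_cast hN0
    have hNB' : N < Fintype.card B := by exact_mod_cast sub_pos.1 hNB
    obtain ⟨r, hr, e1, e2, e3⟩ := exists_relation_length hd hc₂ hc₃ hbound
    obtain ⟨γ, hγ⟩ := (h₁.2 N).2 (by exact_mod_cast hN)
    obtain ⟨T, hT⟩ := exists_subset_sum_eq_of_length hd hc₂ hc₃ h₂ h₃ hsymm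
      (fun f hf => by simpa using hγ f hf) hN0' hNB' rfl hr e1 e2 e3
    have hB0 : (Fintype.card B : ℚ) ≠ 0 := by exact_mod_cast Fintype.card_ne_zero
    have hcard : T.card = N := by
      have := hT _ hone
      simp only [Finset.sum_const, nsmul_eq_mul, mul_one, Finset.card_univ] at this
      rw [div_mul_cancel₀ _ hB0] at this
      exact_mod_cast this
    refine ⟨T, hcard, fun f hf => ?_⟩
    have hN0Q : (N : ℚ) ≠ 0 := by exact_mod_cast hN0'.ne'
    rw [hT f hf, hcard]
    field_simp
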